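/- arXiv:0809.1386 — 2 statements merged into one kernel-verified Lean document; each statement's English description precedes it below -/
import Mathlib

section
/- Let F be a field and let Y be an F-variety such that the reduced subscheme of every irreducible component of Y is smooth over F. Then the following are equivalent: (1) Y contains a closed F-subvariety which is geometrically integral; (2) there exist a geometrically integral F-variety Z and an F-morphism Z → Y; (3) some irreducible component of Y, with its reduced subscheme structure, is geometrically integral over F. -/
open AlgebraicGeometry CategoryTheory CategoryTheory.Limits

/-- The base change of an `F`-scheme `X` (with structure morphism `f : X ⟶ Spec F`) to an
algebraic closure of `F`. -/
noncomputable def geomFiber (F : Type) [Field F] {X : Scheme}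
    (f : X ⟶ Spec (CommRingCat.of F)) : Scheme :=
  pullback f (Spec.map (CommRingCat.ofHom (algebraMap F (AlgebraicClosure F))))

/-- An `F`-scheme is geometrically integral if its base change to an algebraic closure of `F`
is an integral scheme. -/
def GeometricallyIntegral (F : Type) [Field F] {X : Scheme}
    (f : X ⟶ Spec (CommRingCat.of F)) : Prop :=
  IsIntegral (geomFiber F f)

universe u

open TensorProduct in
lemma exists_of_isIdempotentElem_tensor {P S Q : Type*} [CommRing P] [CommRing S] [CommRing Q]
    [Algebra P S] [Algebra P Q] [Algebra.Smooth P S] [IsIntegrallyClosedIn P Q]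
    {t : Q ⊗[P] S} (ht : IsIdempotentElem t) : ∃ s : S, 1 ⊗ₜ s = t := by
  have hint : IsIntegral S (Algebra.TensorProduct.comm P Q S t) :=
    ⟨Polynomial.X ^ 2 - Polynomial.X, Polynomial.monic_X_pow_sub (Polynomial.degree_X_le.trans_lt (by norm_num)), by
      simp [pow_two, ← map_mul, ht.eq]⟩
  obtain ⟨y, hy⟩ := (TensorProduct.toIntegralClosure_bijective_of_smooth (R := P) (S := S)
    (B := Q)).2 ⟨_, hint⟩
  suffices ∀ y, ∃ s : S, (toIntegralClosure P S Q y : S ⊗[P] Q) = s ⊗ₜ 1 by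
    obtain ⟨s, hs⟩ := this y
    refine ⟨s, (Algebra.TensorProduct.comm P Q S).injective ?_⟩
    simp [← hs, hy]
  intro y
  induction y with
  | zero => exact ⟨0, by simp⟩
  | add a b ha hb =>
    obtain ⟨a', ha⟩ := ha
    obtain ⟨b', hb⟩ := hb
    exact ⟨a' + b', by simp [ha, hb, add_tmul]⟩
  | tmul a b =>
    obtain ⟨r, hr⟩ := IsIntegrallyClosedIn.isIntegral_iff.mp b.2
    refine ⟨r • a, ?_⟩
    simp [toIntegralClosure, ← hr, Algebra.algebraMap_eq_smul_one, smul_tmul]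

open TensorProduct in
/-- An étale algebra over an integrally closed domain is locally a domain. -/
lemma Algebra.Etale.exists_isDomain_away {P S : Type u} [CommRing P] [IsDomain P]
    [IsIntegrallyClosed P] [CommRing S] [Algebra P S] [Algebra.Etale P S]
    (p : Ideal S) [p.IsPrime] : ∃ e ∉ p, IsDomain (Localization.Away e) := by
  let Q := FractionRing P
  obtain ⟨I, _, A, _, _, φ, -⟩ := (Algebra.Etale.iff_exists_algEquiv_prod Q (Q ⊗[P] S)).mp
    inferInstance
  classical
  have := Fintype.ofFinite I
  have : IsIntegrallyClosedIn P Q := inferInstance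
  let ψ : S →+* Π i, A i :=
    (φ : Q ⊗[P] S →+* Π i, A i).comp (Algebra.TensorProduct.includeRight : S →ₐ[P] Q ⊗[P] S)
  have hψ : Function.Injective ψ := φ.injective.comp <|
    Algebra.TensorProduct.includeRight_injective (IsFractionRing.injective P Q)
  have hE (i : I) : ∃ s : S, ψ s = Pi.single i 1 := by
    have : IsIdempotentElem (φ.symm (Pi.single i 1)) := by
      simp [IsIdempotentElem, ← map_mul, ← Pi.single_mul]
    obtain ⟨s, hs⟩ := exists_of_isIdempotentElem_tensor this
    exact ⟨s, by simp [ψ, hs]⟩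
  choose E hE using hE
  have hsum : ∑ i, E i = 1 := hψ <| by
    simpa [hE] using Finset.univ_sum_single (1 : Π i, A i)
  obtain ⟨i, hi⟩ : ∃ i, E i ∉ p := by
    by_contra! H
    exact Ideal.IsPrime.ne_top ‹_› (p.eq_top_iff_one.mpr (hsum ▸ sum_mem fun i _ ↦ H i))
  refine ⟨E i, hi, ?_⟩
  let χ : S →+* A i := (Pi.evalRingHom A i).comp ψ
  have hχ : χ (E i) = 1 := by simp [χ, hE]
  have hχ0 (s : S) (hs : χ s = 0) : E i * s = 0 := hψ <| by
    ext j
    by_cases hj : j = i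
    · subst hj
      simpa [hE, χ] using hs
    · simp [hE, hj]
  refine Function.Injective.isDomain
    (IsLocalization.Away.lift (S := Localization.Away (E i)) (E i) (g := χ) (by simp [hχ])) ?_
  rw [injective_iff_map_eq_zero]
  intro x hx
  obtain ⟨n, s, hs⟩ := IsLocalization.Away.surj (E i) x
  have hs0 : χ s = 0 := by
    rw [← IsLocalization.Away.lift_eq (S := Localization.Away (E i)) (E i) (g := χ) (by simp [hχ]),
      ← hs, map_mul, hx, zero_mul]
  have hu : IsUnit (algebraMap S (Localization.Away (E i)) (E i)) :=
    IsLocalization.Away.algebraMap_isUnit _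
  have hs' : algebraMap S (Localization.Away (E i)) s = 0 := by
    rw [← hu.mul_right_eq_zero, ← map_mul, hχ0 s hs0, map_zero]
  rwa [hs', (hu.pow n).mul_left_eq_zero] at hs

/-- A smooth algebra over a field is locally a domain. -/
lemma Algebra.Smooth.exists_isDomain_away {K S : Type u} [Field K] [CommRing S] [Algebra K S]
    [Algebra.Smooth K S] (p : Ideal S) [p.IsPrime] : ∃ f ∉ p, IsDomain (Localization.Away f) := by
  obtain ⟨f, hfp, n, _, _, _⟩ :=
    Algebra.IsSmoothAt.exists_isStandardEtale_mvPolynomial (R := K) (p := p)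
  have : (Ideal.map (algebraMap S (Localization.Away f)) p).IsPrime :=
    IsLocalization.isPrime_of_isPrime_disjoint (.powers f) _ _ ‹_›
      ((Ideal.disjoint_powers_iff_notMem_of_isPrime _).mpr hfp)
  obtain ⟨g₀, hg, H⟩ := Algebra.Etale.exists_isDomain_away (P := MvPolynomial (Fin n) K)
    (p.map (algebraMap S (Localization.Away f)))
  obtain ⟨g, ⟨_, m, rfl⟩, hg₀⟩ := IsLocalization.exists_mk'_eq (.powers f) g₀
  replace hg : g ∉ p := by
    simpa [Submonoid.mem_powers_iff, Ideal.IsPrime.mul_mem_iff_mem_or_mem,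
      IsLocalization.mk'_mem_map_algebraMap_iff, mt (‹p.IsPrime›.mem_of_pow_mem _) hfp,
      ← hg₀] using hg
  have : IsLocalization.Away (f * g) (Localization.Away g₀) := by
    suffices IsLocalization.Away (algebraMap _ (Localization.Away f) g) (Localization.Away g₀) from
      .mul' (Localization.Away f) _ _ _
    refine IsLocalization.Away.of_associated (r := g₀)
      ⟨(IsLocalization.Away.algebraMap_pow_isUnit f m).unit, ?_⟩
    simpa [← hg₀, mul_comm] using IsLocalization.mk'_spec' (Localization.Away f) g
      (⟨f ^ m, m, rfl⟩ : Submonoid.powers f)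
  let e : Localization.Away g₀ ≃ₐ[S] Localization.Away (f * g) :=
    IsLocalization.algEquiv (.powers (f * g)) _ _
  exact ⟨f * g, fun h ↦ (Ideal.IsPrime.mem_or_mem ‹_› h).elim hfp hg,
    e.symm.injective.isDomain (e.symm : _ →+* Localization.Away g₀)⟩

/-- A nonempty connected space which is covered by irreducible open sets is irreducible. -/
lemma irreducibleSpace_of_connectedSpace {X : Type*} [TopologicalSpace X] [ConnectedSpace X]
    (H : ∀ x : X, ∃ U : Set X, IsOpen U ∧ x ∈ U ∧ IsIrreducible U) : IrreducibleSpace X := by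
  obtain ⟨x₀⟩ := ‹ConnectedSpace X›.toNonempty
  have hirr : IsIrreducible (irreducibleComponent x₀) := isIrreducible_irreducibleComponent
  have hopen : IsOpen (irreducibleComponent x₀) := by
    refine isOpen_iff_forall_mem_open.mpr fun x hx ↦ ?_
    obtain ⟨U, hU, hxU, hUi⟩ := H x
    have hle : irreducibleComponent x₀ ⊆ closure U :=
      (subset_closure_inter_of_isPreirreducible_of_isOpen hirr.2 hU ⟨x, hx, hxU⟩).trans
        (closure_mono Set.inter_subset_right)
    have heq : closure U = irreducibleComponent x₀ :=
      eq_irreducibleComponent hUi.closure.2 hle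
    exact ⟨U, heq ▸ subset_closure, hU, hxU⟩
  have huniv := IsClopen.eq_univ ⟨isClosed_irreducibleComponent, hopen⟩ hirr.1
  exact (irreducibleSpace_def X).mpr (by rwa [huniv] at hirr)

namespace AlgebraicGeometry

/-- A smooth scheme over a field is locally integral. -/
lemma Smooth.exists_isOpenImmersion_isIntegral {K : Type u} [Field K] {X : Scheme.{u}}
    (f : X ⟶ Spec (.of K)) [Smooth f] (x : X) :
    ∃ (U : Scheme.{u}) (j : U ⟶ X), IsOpenImmersion j ∧ IsIntegral U ∧ x ∈ Set.range j := by
  obtain ⟨_, ⟨V, hV, rfl⟩, hxV, -⟩ := X.isBasis_affineOpens.exists_subset_of_mem_open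
    (Set.mem_univ x) isOpen_univ
  replace hV : IsAffineOpen V := hV
  obtain ⟨φ, hφ⟩ := Spec.map_surjective (hV.fromSpec ≫ f)
  have hsm : Smooth (Spec.map φ) := hφ ▸ inferInstance
  rw [HasRingHomProperty.Spec_iff (P := @Smooth)] at hsm
  algebraize [φ.hom]
  obtain ⟨q, rfl⟩ : x ∈ Set.range hV.fromSpec := by rwa [hV.range_fromSpec]
  have : q.asIdeal.IsPrime := PrimeSpectrum.isPrime q
  obtain ⟨g, hg, hdom⟩ := Algebra.Smooth.exists_isDomain_away (K := K) q.asIdeal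
  let R := CommRingCat.of (Localization.Away g)
  let i := Spec.map (CommRingCat.ofHom (algebraMap Γ(X, V) (Localization.Away g)))
  have : IsOpenImmersion i := inferInstance
  refine ⟨Spec R, i ≫ hV.fromSpec, inferInstance, (affine_isIntegral_iff R).mpr hdom, ?_⟩
  have hq : q ∈ Set.range i :=
    (PrimeSpectrum.localization_away_comap_range (Localization.Away g) g).ge hg
  obtain ⟨r, rfl⟩ := hq
  exact ⟨r, by simp⟩

/-- A connected smooth scheme over a field is integral. -/
lemma Smooth.isIntegral_of_connectedSpace {K : Type u} [Field K] {X : Scheme.{u}}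
    (f : X ⟶ Spec (.of K)) [Smooth f] [ConnectedSpace X] : IsIntegral X := by
  have H := Smooth.exists_isOpenImmersion_isIntegral f
  have : IrreducibleSpace X := irreducibleSpace_of_connectedSpace fun x ↦ by
    obtain ⟨U, j, _, _, hx⟩ := H x
    refine ⟨Set.range j, j.isOpenEmbedding.isOpen_range, hx, ?_⟩
    rw [← Set.image_univ]
    exact (IrreducibleSpace.isIrreducible_univ U).image j j.continuous.continuousOn
  have : IsReduced X := by
    choose U j hj hU hx using H
    have hred (x : X) : IsReduced (U x) := inferInstance
    let 𝒰 : X.OpenCover := .mkOfCovers X U j (fun x ↦ ⟨x, hx x⟩) hj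
    have (x : 𝒰.I₀) : IsReduced (𝒰.X x) := hred x
    exact IsReduced.of_openCover X 𝒰
  exact isIntegral_of_irreducibleSpace_of_isReduced X

instance {X Y : Scheme.{u}} (f : X ⟶ Y) [QuasiCompact f] :
    IsSchemeTheoreticallyDominant f.toImage := by
  have hU := iSup_affineOpens_eq_top Y
  refine ⟨Scheme.IdealSheafData.ext_of_iSup_eq_top
    (fun U : Y.affineOpens ↦ ⟨f.imageι ⁻¹ᵁ U.1, U.2.preimage f.imageι⟩) ?_ fun U ↦ ?_⟩
  · simp only [← Scheme.Hom.preimage_iSup, hU, Scheme.Hom.preimage_top]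
  · rw [Scheme.Hom.ker_apply, Scheme.IdealSheafData.ideal_bot]
    exact (RingHom.injective_iff_ker_eq_bot _).mp (f.toImage_app_injective U)

/-- An irreducible closed subset carries a reduced closed subscheme structure. -/
lemma exists_isClosedImmersion_isReduced_range_eq {Y : Scheme.{u}} {C : Set Y}
    (hC : IsIrreducible C) (hC' : IsClosed C) :
    ∃ (Z : Scheme.{u}) (ι : Z ⟶ Y), IsClosedImmersion ι ∧ IsReduced Z ∧ Set.range ι = C := by
  obtain ⟨η, hη⟩ := QuasiSober.sober hC hC'
  let i := Y.fromSpecResidueField η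
  have : QuasiCompact i := ⟨fun _ _ _ ↦ (Set.toFinite _).isCompact⟩
  refine ⟨i.image, i.imageι, inferInstance, IsSchemeTheoreticallyDominant.isReduced i.toImage, ?_⟩
  have h : Set.range i.imageι = i.ker.support := i.ker.range_subschemeι
  rw [h, i.support_ker, Scheme.range_fromSpecResidueField]
  exact hη

/-- A morphism from a reduced scheme factors through every closed immersion whose range
contains its range. -/
lemma IsClosedImmersion.exists_comp_eq {X Y Z : Scheme.{u}} [IsReduced X] (g : X ⟶ Y) (ι : Z ⟶ Y)
    [IsClosedImmersion ι] (h : Set.range g ⊆ Set.range ι) : ∃ l : X ⟶ Z, l ≫ ι = g := by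
  have : Surjective (pullback.fst g ι) := by
    refine ⟨Set.range_eq_univ.mp ?_⟩
    rwa [Scheme.Pullback.range_fst, Set.preimage_eq_univ_iff]
  have : IsIso (pullback.fst g ι) := isIso_of_isClosedImmersion_of_surjective _
  exact ⟨inv (pullback.fst g ι) ≫ pullback.snd g ι, by simp [← pullback.condition]⟩

/-- A flat universally closed morphism to an irreducible scheme maps every nonempty clopen subset
onto the target. -/
lemma Flat.image_eq_univ_of_isClopen {X Y : Scheme.{u}} [IrreducibleSpace Y] (p : X ⟶ Y) [Flat p]
    [UniversallyClosed p] {U : Set X} (hU : IsClopen U) (hne : U.Nonempty) :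
    p '' U = Set.univ := by
  obtain ⟨x, hx⟩ := hne
  obtain ⟨x', hx', he⟩ := Flat.generalizingMap p (genericPoint_specializes (p x))
  have hmem : genericPoint Y ∈ p '' U := ⟨x', hx'.mem_open hU.isOpen hx, he⟩
  rw [← (p.isClosedMap U hU.isClosed).closure_eq, Set.eq_univ_iff_forall]
  exact fun y ↦ closure_mono (Set.singleton_subset_iff.mpr hmem)
    ((genericPoint_spec Y).symm ▸ Set.mem_univ y)

/-- Let `X` be an irreducible `S`-scheme and `b : T ⟶ S` a flat universally closed morphism. If some
`S`-scheme mapping to `X` has connected base change along `b`, then so does `X`. -/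
lemma connectedSpace_pullback_of_hom {S T X Z : Scheme.{u}} (h : X ⟶ S) (b : T ⟶ S) [Flat b]
    [UniversallyClosed b] [IrreducibleSpace X] (l : Z ⟶ X)
    [hZ : ConnectedSpace ↥(pullback (l ≫ h) b)] : ConnectedSpace ↥(pullback h b) := by
  let q : pullback (l ≫ h) b ⟶ pullback h b :=
    pullback.lift (pullback.fst _ _ ≫ l) (pullback.snd _ _)
      ((Category.assoc _ _ _).trans pullback.condition)
  have hq₂ : q ≫ pullback.snd h b = pullback.snd (l ≫ h) b := pullback.lift_snd _ _ _
  have hq : IsPullback q (pullback.fst (l ≫ h) b) (pullback.fst h b) l :=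
    .of_right (hq₂ ▸ (IsPullback.of_hasPullback (l ≫ h) b).flip)
      (pullback.lift_fst _ _ _) (IsPullback.of_hasPullback h b).flip
  have key {U : Set ↥(pullback h b)} (hU : IsClopen U) (hne : U.Nonempty) :
      (q ⁻¹' U).Nonempty := by
    obtain ⟨z⟩ := hZ.toNonempty
    obtain ⟨x, hxU, hx⟩ := (Flat.image_eq_univ_of_isClopen (pullback.fst h b) hU hne).ge
      (Set.mem_univ (l (pullback.fst (l ≫ h) b z)))
    obtain ⟨w, hw, -⟩ := Scheme.exists_preimage_of_isPullback hq x _ hx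
    exact ⟨w, by simpa [hw] using hxU⟩
  have : PreconnectedSpace ↥(pullback h b) := by
    refine preconnectedSpace_iff_clopen.mpr fun U hU ↦ ?_
    by_contra! H
    have h₁ := key hU H.1
    have h₂ := key hU.compl (Set.nonempty_compl.mpr H.2)
    rcases isClopen_iff.mp (hU.preimage q.continuous) with h | h
    · simp [h] at h₁
    · simp [Set.preimage_compl, h] at h₂
  exact { toNonempty := hZ.toNonempty.map q }

/-- Let `X` be an irreducible smooth `S`-scheme and `b` a flat universally closed morphism from the
spectrum of a field to `S`. If some `S`-scheme mapping to `X` has integral base change along `b`,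
then so does `X`. -/
lemma isIntegral_pullback_of_hom {L : Type u} [Field L] {S X Z : Scheme.{u}} (h : X ⟶ S)
    (b : Spec (.of L) ⟶ S) [Smooth h] [Flat b] [UniversallyClosed b] [IrreducibleSpace X]
    (l : Z ⟶ X) (hZ : IsIntegral (pullback (l ≫ h) b)) : IsIntegral (pullback h b) := by
  have : ConnectedSpace ↥(pullback h b) := connectedSpace_pullback_of_hom h b l
  exact Smooth.isIntegral_of_connectedSpace (pullback.snd h b)

/-- Integrality descends along the base change of a quasi-compact surjective morphism to a reduced
scheme, for flat schemes over the base. -/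
lemma isIntegral_of_isIntegral_pullback {S T Z : Scheme.{u}} (f : Z ⟶ S) (b : T ⟶ S) [Flat f]
    [IsReduced S] [Surjective b] [QuasiCompact b] [IsIntegral (pullback f b)] : IsIntegral Z := by
  have : IsSchemeTheoreticallyDominant b :=
    (isSchemeTheoreticallyDominant_iff_isDominant _).mpr inferInstance
  have : IsReduced Z := IsSchemeTheoreticallyDominant.isReduced (pullback.fst f b)
  have : IrreducibleSpace Z :=
    (pullback.fst f b).surjective.irreducibleSpace (pullback.fst f b).continuous
  exact isIntegral_of_irreducibleSpace_of_isReduced Z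

end AlgebraicGeometry

/-- Let `h : X ⟶ Spec F` be smooth with `X` irreducible. If some geometrically integral `F`-scheme
maps to `X`, then `X` is geometrically integral. -/
lemma geometricallyIntegral_of_hom {F : Type} [Field F] {X Z : Scheme}
    (h : X ⟶ Spec (CommRingCat.of F)) [Smooth h] [IrreducibleSpace X] (l : Z ⟶ X)
    (hZ : GeometricallyIntegral F (l ≫ h)) : GeometricallyIntegral F h := by
  have : IsIntegralHom (Spec.map (CommRingCat.ofHom (algebraMap F (AlgebraicClosure F)))) := by
    rw [IsIntegralHom.SpecMap_iff]
    exact algebraMap_isIntegral_iff.mpr inferInstance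
  exact isIntegral_pullback_of_hom h _ l hZ

lemma isIntegral_of_geometricallyIntegral {F : Type} [Field F] {Z : Scheme}
    (f : Z ⟶ Spec (CommRingCat.of F)) (hf : GeometricallyIntegral F f) : IsIntegral Z := by
  let b := Spec.map (CommRingCat.ofHom (algebraMap F (AlgebraicClosure F)))
  have : IsIntegral (pullback f b) := hf
  have : Surjective b := inferInstance
  exact isIntegral_of_isIntegral_pullback f b

/-- For an `F`-variety `Y` all of whose irreducible components, with their reduced subscheme
structure, are smooth over `F`, the following are equivalent:
(1) `Y` contains a closed `F`-subvariety which is geometrically integral;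
(2) there is an `F`-morphism to `Y` from some geometrically integral `F`-variety `Z`;
(3) some irreducible component of `Y`, with its reduced structure, is geometrically
integral over `F`. -/
theorem component_geometrically_integral_tfae (F : Type) [Field F]
    (Y : Scheme) (f : Y ⟶ Spec (CommRingCat.of F))
    [IsSeparated f] [LocallyOfFiniteType f] [QuasiCompact f]
    (hsm : ∀ (Z : Scheme) (ι : Z ⟶ Y), IsClosedImmersion ι → IsReduced Z →
      Set.range ι.base ∈ irreducibleComponents Y → IsSmooth (ι ≫ f)) :
    ((∃ (Z : Scheme) (ι : Z ⟶ Y), IsClosedImmersion ι ∧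
        GeometricallyIntegral F (ι ≫ f)) ↔
      (∃ (Z : Scheme) (fZ : Z ⟶ Spec (CommRingCat.of F)) (g : Z ⟶ Y),
        IsSeparated fZ ∧ LocallyOfFiniteType fZ ∧ QuasiCompact fZ ∧
        GeometricallyIntegral F fZ ∧ g ≫ f = fZ)) ∧
    ((∃ (Z : Scheme) (fZ : Z ⟶ Spec (CommRingCat.of F)) (g : Z ⟶ Y),
        IsSeparated fZ ∧ LocallyOfFiniteType fZ ∧ QuasiCompact fZ ∧
        GeometricallyIntegral F fZ ∧ g ≫ f = fZ) ↔
      (∃ (Z : Scheme) (ι : Z ⟶ Y), IsClosedImmersion ι ∧ IsReduced Z ∧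
        Set.range ι.base ∈ irreducibleComponents Y ∧
        GeometricallyIntegral F (ι ≫ f))) := by
  have h₁₂ (H : ∃ (Z : Scheme) (ι : Z ⟶ Y), IsClosedImmersion ι ∧
      GeometricallyIntegral F (ι ≫ f)) :
      ∃ (Z : Scheme) (fZ : Z ⟶ Spec (CommRingCat.of F)) (g : Z ⟶ Y),
        IsSeparated fZ ∧ LocallyOfFiniteType fZ ∧ QuasiCompact fZ ∧
        GeometricallyIntegral F fZ ∧ g ≫ f = fZ := by
    obtain ⟨Z, ι, _, hZ⟩ := H
    exact ⟨Z, ι ≫ f, ι, inferInstance, inferInstance, inferInstance, hZ, rfl⟩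
  have h₂₃ (H : ∃ (Z : Scheme) (fZ : Z ⟶ Spec (CommRingCat.of F)) (g : Z ⟶ Y),
      IsSeparated fZ ∧ LocallyOfFiniteType fZ ∧ QuasiCompact fZ ∧
      GeometricallyIntegral F fZ ∧ g ≫ f = fZ) :
      ∃ (Z : Scheme) (ι : Z ⟶ Y), IsClosedImmersion ι ∧ IsReduced Z ∧
        Set.range ι.base ∈ irreducibleComponents Y ∧ GeometricallyIntegral F (ι ≫ f) := by
    obtain ⟨Z, _, g, _, _, _, hZ, rfl⟩ := H
    have : IsIntegral Z := isIntegral_of_geometricallyIntegral _ hZ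
    obtain ⟨C, hC, hgC⟩ := exists_mem_irreducibleComponents_subset_of_isIrreducible
      (g '' Set.univ) ((IrreducibleSpace.isIrreducible_univ Z).image g g.continuous.continuousOn)
    obtain ⟨X, ι, _, _, rfl⟩ := exists_isClosedImmersion_isReduced_range_eq hC.1
      (isClosed_of_mem_irreducibleComponents C hC)
    obtain ⟨l, rfl⟩ := IsClosedImmersion.exists_comp_eq g ι (by simpa using hgC)
    have : Smooth (ι ≫ f) := hsm X ι inferInstance inferInstance hC
    have : IrreducibleSpace X :=
      ι.isClosedEmbedding.isEmbedding.toHomeomorph.irreducibleSpace_iff.mpr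
        (Subtype.irreducibleSpace hC.1)
    refine ⟨X, ι, inferInstance, inferInstance, hC, geometricallyIntegral_of_hom _ l ?_⟩
    rwa [Category.assoc] at hZ
  have h₃₁ (H : ∃ (Z : Scheme) (ι : Z ⟶ Y), IsClosedImmersion ι ∧ IsReduced Z ∧
      Set.range ι.base ∈ irreducibleComponents Y ∧ GeometricallyIntegral F (ι ≫ f)) :
      ∃ (Z : Scheme) (ι : Z ⟶ Y), IsClosedImmersion ι ∧ GeometricallyIntegral F (ι ≫ f) := by
    obtain ⟨Z, ι, hι, -, -, hZ⟩ := H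
    exact ⟨Z, ι, hι, hZ⟩
  exact ⟨⟨h₁₂, h₃₁ ∘ h₂₃⟩, ⟨h₂₃, h₁₂ ∘ h₃₁⟩⟩
end

section
/- (Ax–Kochen) For every integer d ≥ 1 there exists a finite set S of prime numbers such that for every prime p ∉ S and every integer n > d², every homogeneous polynomial of degree d in n variables over the p-adic field ℚ_p has a nontrivial zero in ℚ_pⁿ. -/
namespace AxKochen

open Polynomial WithZero

/-- A Henselian valued field `K` with value group `ℤ` and an angular component map to its residue
field `k`. The leading term of `x` is the pair `(v x, ac x)`. -/
structure HenselianField (K k : Type) [Field K] [Field k] where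
  /-- the valuation -/
  v : Valuation K ℤᵐ⁰
  /-- the angular component -/
  ac : K →*₀ k
  /-- For every level `γ`, the coefficient at level `γ` is additive on `{x | v x ≤ γ}`. -/
  ac_add : ∀ γ ≠ 0, ∀ x y, v x ≤ γ → v y ≤ γ → (if v (x + y) = γ then ac (x + y) else 0) =
    (if v x = γ then ac x else 0) + (if v y = γ then ac y else 0)
  exists_lift : ∀ γ ≠ 0, ∀ ξ ≠ 0, ∃ x, v x = γ ∧ ac x = ξ
  hensel : ∀ F : K[X], (∀ i, v (F.coeff i) ≤ 1) → v (F.eval 1) < 1 →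
    v (F.derivative.eval 1) = 1 → ∃ β, F.eval β = 0 ∧ v (β - 1) < 1

variable {K L k : Type} [Field K] [Field L] [Field k]

namespace HenselianField

/-- The residue characteristic is `0` or larger than `N`. -/
def ResidueCharGT (A : HenselianField K k) (N : ℕ) : Prop :=
  ∀ n : ℕ, 1 ≤ n → n ≤ N → A.v (n : K) = 1

/-- Elements of two Henselian fields with the same leading term. -/
def SameLead (A : HenselianField K k) (B : HenselianField L k) (x : K) (y : L) : Prop :=
  A.v x = B.v y ∧ A.ac x = B.ac y

/-- The Taylor expansion of `P` at `c`, evaluated at `a`, has no cancellation of leading terms. -/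
def NoCancel (A : HenselianField K k) (P : K[X]) (a c : K) : Prop :=
  ∀ i, A.v ((taylor c P).coeff i * (a - c) ^ i) ≤ A.v (P.eval a)

section SameLead

variable {A : HenselianField K k} {B : HenselianField L k}

lemma SameLead.symm {x : K} {y : L} (h : A.SameLead B x y) : B.SameLead A y x :=
  ⟨h.1.symm, h.2.symm⟩

lemma SameLead.zero : A.SameLead B 0 0 := by simp [SameLead]

lemma SameLead.mul {x x' : K} {y y' : L} (h : A.SameLead B x y) (h' : A.SameLead B x' y') :
    A.SameLead B (x * x') (y * y') := by
  simp [SameLead, h.1, h.2, h'.1, h'.2]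

lemma SameLead.pow {x : K} {y : L} (h : A.SameLead B x y) (n : ℕ) :
    A.SameLead B (x ^ n) (y ^ n) := by
  simp [SameLead, h.1, h.2]

lemma SameLead.eq_zero_iff {x : K} {y : L} (h : A.SameLead B x y) : x = 0 ↔ y = 0 := by
  rw [← A.v.zero_iff, h.1, B.v.zero_iff]

lemma SameLead.of_mul_left {x x' : K} {y y' : L} (h : A.SameLead B x y) (hx : x ≠ 0)
    (h' : A.SameLead B (x * x') (y * y')) : A.SameLead B x' y' := by
  obtain ⟨h1, h2⟩ := h'
  have hy : y ≠ 0 := fun hy => hx (h.eq_zero_iff.2 hy)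
  rw [map_mul, map_mul, h.1] at h1
  rw [map_mul, map_mul, h.2] at h2
  exact ⟨mul_left_cancel₀ ((B.v.ne_zero_iff).2 hy) h1,
    mul_left_cancel₀ ((map_ne_zero B.ac).2 hy) h2⟩

lemma ac_eq_of_v_sub_lt (A : HenselianField K k) {x x' : K} (h : A.v (x - x') < A.v x) :
    A.v x' = A.v x ∧ A.ac x' = A.ac x := by
  have h0 : A.v x ≠ 0 := (zero_le.trans_lt h).ne'
  have hv : A.v x' = A.v x := by
    rw [Valuation.map_sub_swap] at h
    exact Valuation.map_eq_of_sub_lt A.v h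
  refine ⟨hv, ?_⟩
  have := A.ac_add (A.v x) h0 (x - x') x' h.le hv.le
  simpa [h.ne, hv] using this.symm

lemma SameLead.of_v_sub_lt {x : K} {y y' : L} (h : A.SameLead B x y) (hy : B.v (y - y') < B.v y) :
    A.SameLead B x y' := by
  obtain ⟨h1, h2⟩ := B.ac_eq_of_v_sub_lt hy
  exact ⟨h.1.trans h1.symm, h.2.trans h2.symm⟩

lemma exists_sameLead (A : HenselianField K k) (B : HenselianField L k) (x : K) :
    ∃ y, A.SameLead B x y := by
  by_cases hx : x = 0
  · exact ⟨0, hx ▸ SameLead.zero⟩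
  · obtain ⟨y, h1, h2⟩ := B.exists_lift (A.v x) (A.v.ne_zero_iff.2 hx) (A.ac x)
      ((map_ne_zero A.ac).2 hx)
    exact ⟨y, h1.symm, h2.symm⟩

lemma ac_sum (A : HenselianField K k) {γ : ℤᵐ⁰} (hγ : γ ≠ 0) {ι : Type*} (s : Finset ι)
    (x : ι → K) (h : ∀ i ∈ s, A.v (x i) ≤ γ) :
    (if A.v (∑ i ∈ s, x i) = γ then A.ac (∑ i ∈ s, x i) else 0) =
      ∑ i ∈ s, if A.v (x i) = γ then A.ac (x i) else 0 := by
  classical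
  induction s using Finset.induction_on with
  | empty => simp
  | insert i s hi ih =>
    rw [Finset.sum_insert hi, Finset.sum_insert hi,
      A.ac_add γ hγ _ _ (h i (by simp)) (A.v.map_sum_le fun j hj => h j (by simp [hj])),
      ih fun j hj => h j (by simp [hj])]

lemma SameLead.sum {ι : Type*} {s : Finset ι} {x : ι → K} {y : ι → L}
    (h : ∀ i ∈ s, A.SameLead B (x i) (y i)) (hx : ∀ i ∈ s, A.v (x i) ≤ A.v (∑ i ∈ s, x i)) :
    A.SameLead B (∑ i ∈ s, x i) (∑ i ∈ s, y i) := by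
  by_cases h0 : ∑ i ∈ s, x i = 0
  · have hy : ∀ i ∈ s, y i = 0 := fun i hi => by
      have := hx i hi
      rw [h0, map_zero, le_zero_iff, A.v.zero_iff] at this
      exact (h i hi).eq_zero_iff.1 this
    rw [h0, Finset.sum_eq_zero hy]
    exact SameLead.zero
  · have hγ : A.v (∑ i ∈ s, x i) ≠ 0 := A.v.ne_zero_iff.2 h0
    have e1 := A.ac_sum hγ s x hx
    have e2 := B.ac_sum hγ s y fun i hi => (h i hi).1 ▸ hx i hi
    have e3 : ∑ i ∈ s, (if A.v (x i) = A.v (∑ i ∈ s, x i) then A.ac (x i) else 0) =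
        ∑ i ∈ s, (if B.v (y i) = A.v (∑ i ∈ s, x i) then B.ac (y i) else 0) :=
      Finset.sum_congr rfl fun i hi => by rw [(h i hi).1, (h i hi).2]
    rw [← e1, ← e2, if_pos rfl] at e3
    split_ifs at e3 with hc
    · exact ⟨hc.symm, e3⟩
    · exact absurd e3 ((map_ne_zero A.ac).2 h0)

end SameLead

lemma eval_eq_sum_taylor (P : K[X]) (a c : K) {n : ℕ} (hn : P.natDegree < n) :
    P.eval a = ∑ i ∈ Finset.range n, (taylor c P).coeff i * (a - c) ^ i := by
  rw [← taylor_eval_sub c P a, eval_eq_sum_range' (by rwa [natDegree_taylor])]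

lemma taylor_coeff_derivative (P : K[X]) (c : K) (i : ℕ) :
    (taylor c (derivative P)).coeff i = (taylor c P).coeff (i + 1) * ((i + 1 : ℕ) : K) := by
  have : taylor c (derivative P) = derivative (taylor c P) := by
    simp [taylor_apply, derivative_comp]
  rw [this, coeff_derivative]
  push_cast
  rfl

variable {A : HenselianField K k} {B : HenselianField L k}

lemma NoCancel.sameLead_eval {P : K[X]} {Q : L[X]} {a c : K} {b c' : L}
    (hP : A.NoCancel P a c)
    (hc : ∀ i, A.SameLead B ((taylor c P).coeff i) ((taylor c' Q).coeff i))
    (hab : A.SameLead B (a - c) (b - c')) : A.SameLead B (P.eval a) (Q.eval b) := by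
  have h1 := eval_eq_sum_taylor P a c (n := max P.natDegree Q.natDegree + 1) (by omega)
  have h2 := eval_eq_sum_taylor Q b c' (n := max P.natDegree Q.natDegree + 1) (by omega)
  have := hP
  rw [NoCancel, h1] at this
  rw [h1, h2]
  exact SameLead.sum (fun i _ => (hc i).mul (hab.pow i)) fun i _ => this i

lemma NoCancel.transfer {P : K[X]} {Q : L[X]} {a c : K} {b c' : L}
    (hP : A.NoCancel P a c)
    (hc : ∀ i, A.SameLead B ((taylor c P).coeff i) ((taylor c' Q).coeff i))
    (hab : A.SameLead B (a - c) (b - c')) : B.NoCancel Q b c' := by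
  intro i
  rw [← ((hc i).mul (hab.pow i)).1, ← (hP.sameLead_eval hc hab).1]
  exact hP i

/-- If `P'` has no cancellation at `c`, then either neither has `P`, or `P` has a root which is
closer to `a` than `c` is. -/
lemma NoCancel.or_exists_root {P : K[X]} {a c : K} {N : ℕ} (hA : A.ResidueCharGT N)
    (hN : P.natDegree ≤ N) (hP' : A.NoCancel (derivative P) a c) :
    A.NoCancel P a c ∨ ∃ c', P.eval c' = 0 ∧ A.v (a - c') < A.v (a - c) := by
  by_cases hP : A.NoCancel P a c
  · exact Or.inl hP
  right
  set t : ℕ → K := fun i => (taylor c P).coeff i * (a - c) ^ i with ht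
  have hsum : P.eval a = ∑ i ∈ Finset.range (N + 1), t i := eval_eq_sum_taylor P a c (by omega)
  have ht0 : ∀ i, N < i → t i = 0 := fun i hi => by
    simp [ht, coeff_eq_zero_of_natDegree_lt (show (taylor c P).natDegree < i by
      rw [natDegree_taylor]; omega)]
  obtain ⟨m, -, hm⟩ := Finset.exists_max_image (Finset.range (N + 1)) (fun i => A.v (t i)) (by simp)
  have hmax : ∀ i, A.v (t i) ≤ A.v (t m) := fun i => by
    by_cases hi : i ≤ N
    · exact hm i (by simp; omega)
    · rw [ht0 i (by omega), map_zero]; exact zero_le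
  have hlt : A.v (P.eval a) < A.v (t m) := by
    rw [NoCancel] at hP
    push Not at hP
    obtain ⟨i, hi⟩ := hP
    exact hi.trans_le (hmax i)
  have hM : A.v (t m) ≠ 0 := (zero_le.trans_lt hlt).ne'
  have he : t m ≠ 0 := A.v.ne_zero_iff.1 hM
  -- the non-constant terms are dominated by `(a - c) * P'(a)`
  have hder : ∀ i, A.v (t (i + 1)) ≤ A.v ((derivative P).eval a * (a - c)) := fun i => by
    by_cases hi : i + 1 ≤ N
    · have := hP' i
      rw [taylor_coeff_derivative, map_mul, map_mul, hA (i + 1) (by omega) hi, mul_one,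
        ← map_mul] at this
      simp only [ht]
      rw [pow_succ, ← mul_assoc, map_mul, map_mul _ (eval _ _)]
      exact mul_le_mul_left this _
    · rw [ht0 _ (by omega), map_zero]; exact zero_le
  have hge : A.v (t m) ≤ A.v ((derivative P).eval a * (a - c)) := by
    by_contra! hcon
    have hsmall : ∀ i, A.v (t (i + 1)) < A.v (t m) := fun i => (hder i).trans_lt hcon
    have hm0 : m = 0 := by
      rcases m with _ | m
      · rfl
      · exact absurd (hsmall m) (lt_irrefl _)
    subst hm0
    rw [Finset.sum_range_succ'] at hsum
    have h1 : A.v (∑ i ∈ Finset.range N, t (i + 1)) < A.v (t 0) :=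
      A.v.map_sum_lt hM fun i _ => hsmall i
    rw [hsum, Valuation.map_add_eq_of_lt_right _ h1] at hlt
    exact lt_irrefl _ hlt
  have hac : a - c ≠ 0 := by
    rintro h
    rw [h, mul_zero, map_zero] at hge
    exact hM (le_zero_iff.1 hge)
  set F : K[X] := C (t m)⁻¹ * (taylor c P).comp (C (a - c) * X) with hF
  have hFc : ∀ i, F.coeff i = (t m)⁻¹ * t i := fun i => by
    rw [hF, coeff_C_mul, comp_C_mul_X_coeff]
  have hFe : ∀ x, F.eval x = (t m)⁻¹ * P.eval (c + (a - c) * x) := fun x => by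
    simp [hF, eval_comp, taylor_eval, add_comm]
  have hFd : F.derivative.eval 1 = (t m)⁻¹ * ((derivative P).eval a * (a - c)) := by
    simp only [hF, derivative_comp, eval_comp, taylor_apply, derivative_mul, derivative_C,
      derivative_X, derivative_add, eval_mul, eval_add, eval_C, eval_X, eval_zero, eval_one]
    ring_nf
  have hFint : ∀ i, A.v (F.coeff i) ≤ 1 := fun i => by
    rw [hFc, map_mul, map_inv₀]
    exact inv_mul_le_one_of_le₀ (hmax i) zero_le
  have hF1 : A.v (F.eval 1) < 1 := by
    rw [hFe, map_mul, map_inv₀, mul_one, add_sub_cancel]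
    rwa [inv_mul_lt_iff₀ (zero_lt_iff.2 hM), mul_one]
  have hFd1 : A.v (F.derivative.eval 1) = 1 := by
    apply le_antisymm
    · rw [eval_eq_sum_range]
      refine A.v.map_sum_le fun i _ => ?_
      rw [coeff_derivative, one_pow, mul_one, map_mul]
      refine mul_le_one₀ (hFint _) zero_le ?_
      exact_mod_cast (A.v.mem_integer_iff _).1 (natCast_mem A.v.integer (i + 1))
    · rw [hFd, map_mul, map_inv₀]
      rwa [le_inv_mul_iff₀ (zero_lt_iff.2 hM), mul_one]
  obtain ⟨β, hβ, hβ1⟩ := A.hensel F hFint hF1 hFd1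
  refine ⟨c + (a - c) * β, ?_, ?_⟩
  · rw [hFe] at hβ
    exact (mul_eq_zero.1 hβ).resolve_left (inv_ne_zero he)
  · have : a - (c + (a - c) * β) = (a - c) * (1 - β) := by ring
    rw [this, map_mul, A.v.map_sub_swap 1 β]
    exact mul_lt_of_lt_one_right (zero_lt_iff.2 (A.v.ne_zero_iff.2 hac)) hβ1

/-- A finite set of polynomials closed under derivation has a common center around which there is
no cancellation at `a`; it is `0` or a root of one of the polynomials. -/
lemma exists_center {N : ℕ} (hA : A.ResidueCharGT N) (𝓟 : Finset K[X])
    (hN : ∀ P ∈ 𝓟, P.natDegree ≤ N) (hd : ∀ P ∈ 𝓟, derivative P ∈ 𝓟) (a : K) :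
    ∃ c, (c = 0 ∨ ∃ P ∈ 𝓟, P ≠ 0 ∧ P.eval c = 0) ∧ ∀ P ∈ 𝓟, A.NoCancel P a c := by
  classical
  obtain ⟨c, hc, hmin⟩ := Finset.exists_min_image
    (insert 0 (𝓟.biUnion fun P => P.roots.toFinset)) (fun c => A.v (a - c)) (by simp)
  refine ⟨c, ?_, ?_⟩
  · simpa [Finset.mem_insert, Finset.mem_biUnion] using hc
  suffices ∀ n, ∀ P ∈ 𝓟, P.natDegree < n → A.NoCancel P a c from
    fun P hP => this _ P hP (Nat.lt_succ_self _)
  intro n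
  induction n with
  | zero => intro P _ h; omega
  | succ n ih =>
    intro P hP hn
    have hder : A.NoCancel (derivative P) a c := by
      by_cases h0 : P.natDegree = 0
      · rw [derivative_of_natDegree_zero h0]
        intro i
        simp
      · exact ih _ (hd P hP) ((natDegree_derivative_lt h0).trans_le (by omega))
    by_cases hP0 : P = 0
    · intro i
      simp [hP0]
    refine (hder.or_exists_root hA (hN P hP)).resolve_right ?_
    rintro ⟨c', hc', hlt⟩
    refine (hmin c' ?_).not_gt hlt
    simp only [Finset.mem_insert, Finset.mem_biUnion, Multiset.mem_toFinset]
    exact Or.inr ⟨P, hP, (mem_roots hP0).2 hc'⟩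

section
variable {K L k : Type} [Field K] [Field L] [Field k]
variable {A : HenselianField K k} {B : HenselianField L k}

lemma ResidueCharGT.mono {M N : ℕ} (h : A.ResidueCharGT N) (hMN : M ≤ N) : A.ResidueCharGT M :=
  fun n h1 h2 => h n h1 (h2.trans hMN)

/-- Transfer of a root along matching Taylor expansions at centers `c` and `c'`. -/
lemma NoCancel.exists_root_transfer {P : K[X]} {Q : L[X]} {a c : K} {c' : L} {N : ℕ}
    (hB : B.ResidueCharGT N) (hN : Q.natDegree ≤ N) (hP' : A.NoCancel (derivative P) a c)
    (hc : ∀ i, A.SameLead B ((taylor c P).coeff i) ((taylor c' Q).coeff i))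
    (hc' : ∀ i, A.SameLead B ((taylor c (derivative P)).coeff i)
      ((taylor c' (derivative Q)).coeff i)) (ha : P.eval a = 0) :
    ∃ b, Q.eval b = 0 ∧ A.SameLead B (a - c) (b - c') := by
  obtain ⟨y, hy⟩ := exists_sameLead A B (a - c)
  have hb : A.SameLead B (a - c) ((y + c') - c') := by rwa [add_sub_cancel_right]
  rcases (hP'.transfer hc' hb).or_exists_root hB hN with h | ⟨b, hb0, hlt⟩
  · have := h.sameLead_eval (fun i => (hc i).symm) hb.symm
    exact ⟨_, this.eq_zero_iff.2 ha, hb⟩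
  · refine ⟨b, hb0, hb.of_v_sub_lt ?_⟩
    rwa [sub_sub_sub_cancel_right]

end

/-- The two specializations `φ`, `ψ` of `R` give the same leading terms on `Q`, in fields of
residue characteristic larger than `N`. -/
structure Matches {R K L k : Type} [CommRing R] [Field K] [Field L] [Field k]
    (A : HenselianField K k) (B : HenselianField L k) (φ : R →+* K) (ψ : R →+* L)
    (Q : Finset R) (N : ℕ) : Prop where
  left : A.ResidueCharGT N
  right : B.ResidueCharGT N
  sameLead : ∀ q ∈ Q, A.SameLead B (φ q) (ψ q)

lemma Matches.mono {R K L k : Type} [CommRing R] [Field K] [Field L] [Field k]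
    {A : HenselianField K k} {B : HenselianField L k} {φ : R →+* K} {ψ : R →+* L}
    {Q Q' : Finset R} {N N' : ℕ} (h : Matches A B φ ψ Q N) (hQ : Q' ⊆ Q) (hN : N' ≤ N) :
    Matches A B φ ψ Q' N' :=
  ⟨h.left.mono hN, h.right.mono hN, fun q hq => h.sameLead q (hQ hq)⟩

section Elimination
variable {R : Type} [CommRing R]

/-- Roots of `P₀` can be transferred, with the leading terms of any finite set of polynomials. -/
def RootTransfer (P₀ : R[X]) : Prop :=
  ∀ 𝓟 : Finset R[X], ∃ (Q : Finset R) (N : ℕ), ∀ (K L k : Type) [Field K] [Field L] [Field k]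
    (A : HenselianField K k) (B : HenselianField L k) (φ : R →+* K) (ψ : R →+* L),
    Matches A B φ ψ Q N → ∀ a : K, P₀.map φ ≠ 0 → (P₀.map φ).eval a = 0 →
      ∃ b : L, (P₀.map ψ).eval b = 0 ∧
        ∀ P ∈ 𝓟, A.SameLead B ((P.map φ).eval a) ((P.map ψ).eval b)

lemma taylor_coeff_map {S : Type} [CommRing S] (φ : R →+* S) (P : R[X]) (c : S) (i : ℕ) :
    (taylor c (P.map φ)).coeff i = ((hasseDeriv i P).map φ).eval c := by
  rw [taylor_coeff]
  congr 1
  ext n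
  simp [hasseDeriv_coeff]

lemma exists_center_transfer (𝓣 : Finset R[X]) (hd : ∀ P ∈ 𝓣, derivative P ∈ 𝓣)
    (hT : ∀ P ∈ 𝓣, RootTransfer P) (𝓖 : Finset R[X]) :
    ∃ (Q : Finset R) (N : ℕ), ∀ (K L k : Type) [Field K] [Field L] [Field k]
    (A : HenselianField K k) (B : HenselianField L k) (φ : R →+* K) (ψ : R →+* L),
    Matches A B φ ψ Q N → ∀ a : K, ∃ (c : K) (c' : L), (∀ P ∈ 𝓣, A.NoCancel (P.map φ) a c) ∧
      ∀ P ∈ 𝓖, ∀ i, A.SameLead B ((taylor c (P.map φ)).coeff i)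
        ((taylor c' (P.map ψ)).coeff i) := by
  classical
  set 𝓗 : Finset R[X] := 𝓖.biUnion fun P =>
    (Finset.range (P.natDegree + 1)).image fun i => hasseDeriv i P with h𝓗
  choose! Qf Nf hf using fun (P : R[X]) (hP : P ∈ 𝓣) => hT P hP 𝓗
  refine ⟨𝓣.biUnion Qf ∪ 𝓗.image fun P => P.coeff 0, 𝓣.sup Nf ⊔ 𝓣.sup natDegree, ?_⟩
  intro K L k _ _ _ A B φ ψ hM a
  have hcenter := exists_center (hM.left.mono le_sup_right) (𝓣.image (Polynomial.map φ))
    (by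
      simp only [Finset.forall_mem_image]
      exact fun P hP => (natDegree_map_le).trans (Finset.le_sup (f := natDegree) hP))
    (by
      simp only [Finset.forall_mem_image]
      exact fun P hP => Finset.mem_image.2 ⟨_, hd P hP, (derivative_map P φ).symm⟩) a
  simp only [Finset.forall_mem_image, Finset.exists_mem_image] at hcenter
  obtain ⟨c, hc, hnc⟩ := hcenter
  obtain ⟨c', hc'⟩ : ∃ c', ∀ P ∈ 𝓗, A.SameLead B ((P.map φ).eval c) ((P.map ψ).eval c') := by
    rcases hc with rfl | ⟨P, hP, hP0, hPc⟩
    · refine ⟨0, fun P hP => ?_⟩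
      rw [← coeff_zero_eq_eval_zero, ← coeff_zero_eq_eval_zero, coeff_map, coeff_map]
      exact hM.sameLead _ (Finset.mem_union_right _ (Finset.mem_image_of_mem _ hP))
    · obtain ⟨b, -, hb⟩ := hf P hP K L k A B φ ψ
        (hM.mono ((Finset.subset_biUnion_of_mem Qf hP).trans Finset.subset_union_left)
          ((Finset.le_sup hP).trans le_sup_left)) c hP0 hPc
      exact ⟨b, hb⟩
  refine ⟨c, c', fun P hP => hnc hP, fun P hP i => ?_⟩
  rw [taylor_coeff_map, taylor_coeff_map]
  by_cases hi : i ≤ P.natDegree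
  · exact hc' _ (Finset.mem_biUnion.2 ⟨P, hP, Finset.mem_image.2 ⟨i, by simp; omega, rfl⟩⟩)
  · rw [hasseDeriv_eq_zero_of_lt_natDegree P i (by omega)]
    simpa using SameLead.zero

lemma exists_derivative_closure (𝓢 : Finset R[X]) (n : ℕ) (hn : ∀ P ∈ 𝓢, P.natDegree < n) :
    ∃ 𝓣 : Finset R[X], 𝓢 ⊆ 𝓣 ∧ (∀ P ∈ 𝓣, derivative P ∈ 𝓣) ∧ ∀ P ∈ 𝓣, P.natDegree < n := by
  classical
  refine ⟨(𝓢 ×ˢ Finset.range (n + 1)).image fun x => derivative^[x.2] x.1, ?_, ?_, ?_⟩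
  · intro P hP
    exact Finset.mem_image.2 ⟨(P, 0), by simp [hP], rfl⟩
  · simp only [Finset.forall_mem_image, Finset.mem_product, Finset.mem_range, Prod.forall]
    rintro P i ⟨hP, hi⟩
    rw [← Function.iterate_succ_apply' derivative]
    by_cases hi' : i < n
    · exact Finset.mem_image.2 ⟨(P, i + 1), by simp [hP, hi'], rfl⟩
    · have h1 := hn P hP
      refine Finset.mem_image.2 ⟨(P, n), by simp [hP], ?_⟩
      simp only
      rw [iterate_derivative_eq_zero h1, iterate_derivative_eq_zero (by omega)]
  · simp only [Finset.forall_mem_image, Finset.mem_product, Finset.mem_range, Prod.forall]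
    rintro P i ⟨hP, -⟩
    exact ((natDegree_iterate_derivative P i).trans (Nat.sub_le _ _)).trans_lt (hn P hP)

/-- Pseudo-division of polynomials. -/
lemma exists_pseudo_remainder (P₀ : R[X]) (h0 : P₀.natDegree ≠ 0) (P : R[X]) :
    ∃ (m : ℕ) (D S : R[X]), C (P₀.leadingCoeff ^ m) * P = D * P₀ + S ∧
      S.natDegree < P₀.natDegree := by
  suffices ∀ n, ∀ P : R[X], P.natDegree < n → ∃ (m : ℕ) (D S : R[X]),
      C (P₀.leadingCoeff ^ m) * P = D * P₀ + S ∧ S.natDegree < P₀.natDegree from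
    this _ P (Nat.lt_succ_self _)
  intro n
  induction n with
  | zero => intro P h; omega
  | succ n ih =>
    intro P hP
    by_cases hlt : P.natDegree < P₀.natDegree
    · exact ⟨0, 0, P, by simp, hlt⟩
    obtain ⟨m, D, S, h, hS⟩ := ih (P₀.cancelLeads P)
      ((natDegree_cancelLeads_lt_of_natDegree_le_natDegree (by omega) (by omega)).trans_le
        (by omega))
    refine ⟨m + 1, D + C (P₀.leadingCoeff ^ m) *
      (C P.leadingCoeff * X ^ (P.natDegree - P₀.natDegree)), S, ?_, hS⟩
    rw [cancelLeads, show P₀.natDegree - P.natDegree = 0 by omega] at h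
    simp only [C_pow, pow_succ, pow_zero, mul_one, map_mul] at h ⊢
    linear_combination h

theorem rootTransfer (P₀ : R[X]) : RootTransfer P₀ := by
  classical
  suffices ∀ n, ∀ P₀ : R[X], P₀.natDegree < n → RootTransfer P₀ from
    this _ P₀ (Nat.lt_succ_self _)
  intro n
  induction n with
  | zero => intro P h; omega
  | succ n ih =>
    intro P₀ hn 𝓟
    by_cases h0 : P₀.natDegree = 0
    · refine ⟨∅, 0, fun K L k _ _ _ A B φ ψ _ a hne ha => absurd ?_ hne⟩
      rw [eq_C_of_natDegree_eq_zero h0] at ha ⊢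
      simpa using ha
    obtain ⟨Q₁, N₁, h₁⟩ := ih P₀.eraseLead
      ((eraseLead_natDegree_lt_or_eraseLead_eq_zero P₀).elim (fun h => h.trans_le (by omega))
        (fun h => by rw [h, natDegree_zero]; omega)) 𝓟
    choose m D S hS hSdeg using exists_pseudo_remainder P₀ h0
    obtain ⟨𝓣, hsub, hd, hdeg⟩ := exists_derivative_closure
      (insert (derivative P₀) (𝓟.image S)) P₀.natDegree (by
        intro P hP
        rcases Finset.mem_insert.1 hP with rfl | hP
        · exact natDegree_derivative_lt h0
        · obtain ⟨P, -, rfl⟩ := Finset.mem_image.1 hP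
          exact hSdeg P)
    obtain ⟨Q₂, N₂, h₂⟩ := exists_center_transfer 𝓣 hd
      (fun P hP => ih P ((hdeg P hP).trans_le (by omega))) (insert P₀ 𝓣)
    refine ⟨insert P₀.leadingCoeff (Q₁ ∪ Q₂), N₁ ⊔ N₂ ⊔ P₀.natDegree, ?_⟩
    intro K L k _ _ _ A B φ ψ hM a hne ha
    have hlc : A.SameLead B (φ P₀.leadingCoeff) (ψ P₀.leadingCoeff) :=
      hM.sameLead _ (Finset.mem_insert_self _ _)
    by_cases hlc0 : φ P₀.leadingCoeff = 0
    · have erase : ∀ {F : Type} [Field F] (χ : R →+* F), χ P₀.leadingCoeff = 0 →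
          P₀.map χ = P₀.eraseLead.map χ := fun χ hχ => by
        conv_lhs => rw [← eraseLead_add_C_mul_X_pow P₀, Polynomial.map_add, Polynomial.map_mul,
          map_C, hχ, C_0, zero_mul, add_zero]
      rw [erase φ hlc0] at hne ha
      rw [erase ψ (hlc.eq_zero_iff.1 hlc0)]
      exact h₁ K L k A B φ ψ (hM.mono
        (Finset.subset_union_left.trans (Finset.subset_insert _ _))
        (le_sup_left.trans le_sup_left)) a hne ha
    obtain ⟨c, c', hnc, hcc⟩ := h₂ K L k A B φ ψ (hM.mono
        (Finset.subset_union_right.trans (Finset.subset_insert _ _))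
        (le_sup_right.trans le_sup_left)) a
    have hP₀' : derivative P₀ ∈ 𝓣 := hsub (Finset.mem_insert_self _ _)
    obtain ⟨b, hb0, hb⟩ := NoCancel.exists_root_transfer (P := P₀.map φ) (Q := P₀.map ψ)
      (hM.right.mono le_sup_right) natDegree_map_le
      (by rw [derivative_map]; exact hnc _ hP₀') (hcc _ (Finset.mem_insert_self _ _))
      (by
        rw [derivative_map, derivative_map]
        exact hcc _ (Finset.mem_insert_of_mem hP₀')) ha
    refine ⟨b, hb0, fun P hP => ?_⟩
    have hSP : S P ∈ 𝓣 := hsub (Finset.mem_insert_of_mem (Finset.mem_image_of_mem S hP))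
    have key := (hnc _ hSP).sameLead_eval (hcc _ (Finset.mem_insert_of_mem hSP)) hb
    have rem : ∀ {F : Type} [Field F] (χ : R →+* F) (x : F), (P₀.map χ).eval x = 0 →
        ((S P).map χ).eval x = χ P₀.leadingCoeff ^ m P * (P.map χ).eval x := fun χ x hx => by
      have := congrArg (fun G => (G.map χ).eval x) (hS P)
      simpa [hx] using this.symm
    rw [rem φ a ha, rem ψ b hb0] at key
    exact (hlc.pow (m P)).of_mul_left (pow_ne_zero _ hlc0) key

/-- Elimination of one variable. -/
theorem exists_transfer (𝓟 : Finset R[X]) : ∃ (Q : Finset R) (N : ℕ),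
    ∀ (K L k : Type) [Field K] [Field L] [Field k]
    (A : HenselianField K k) (B : HenselianField L k) (φ : R →+* K) (ψ : R →+* L),
    Matches A B φ ψ Q N → ∀ a : K, ∃ b : L,
      ∀ P ∈ 𝓟, A.SameLead B ((P.map φ).eval a) ((P.map ψ).eval b) := by
  obtain ⟨𝓣, hsub, hd, -⟩ := exists_derivative_closure 𝓟 (𝓟.sup natDegree + 1)
    fun P hP => Nat.lt_succ_of_le (Finset.le_sup (f := natDegree) hP)
  obtain ⟨Q, N, h⟩ := exists_center_transfer 𝓣 hd (fun P _ => rootTransfer P) 𝓣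
  refine ⟨Q, N, fun K L k _ _ _ A B φ ψ hM a => ?_⟩
  obtain ⟨c, c', hnc, hcc⟩ := h K L k A B φ ψ hM a
  obtain ⟨y, hy⟩ := exists_sameLead A B (a - c)
  refine ⟨y + c', fun P hP => (hnc P (hsub hP)).sameLead_eval (hcc P (hsub hP)) ?_⟩
  rwa [add_sub_cancel_right]

end Elimination

/-- Elimination of finitely many variables. -/
theorem exists_transfer_mvPolynomial (m : ℕ) : ∀ {R : Type} [CommRing R]
    (𝓟 : Finset (MvPolynomial (Fin m) R)), ∃ (Q : Finset R) (N : ℕ),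
    ∀ (K L k : Type) [Field K] [Field L] [Field k]
    (A : HenselianField K k) (B : HenselianField L k) (φ : R →+* K) (ψ : R →+* L),
    Matches A B φ ψ Q N → ∀ x : Fin m → K, ∃ y : Fin m → L,
      Matches A B (MvPolynomial.eval₂Hom φ x) (MvPolynomial.eval₂Hom ψ y) 𝓟 N := by
  classical
  induction m with
  | zero =>
    intro R _ 𝓟
    refine ⟨𝓟.image (MvPolynomial.constantCoeff), 0, ?_⟩
    intro K L k _ _ _ A B φ ψ hM x
    refine ⟨Fin.elim0, hM.left, hM.right, fun P hP => ?_⟩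
    have := hM.sameLead _ (Finset.mem_image_of_mem _ hP)
    have e : ∀ {F : Type} [Field F] (χ : R →+* F) (x : Fin 0 → F),
        MvPolynomial.eval₂Hom χ x P = χ (MvPolynomial.constantCoeff P) := by
      intro F _ χ x
      obtain ⟨r, rfl⟩ := MvPolynomial.C_surjective (Fin 0) P
      simp
    rwa [e, e]
  | succ m ih =>
    intro R _ 𝓟
    obtain ⟨Q, N, h⟩ := exists_transfer (𝓟.image (MvPolynomial.finSuccEquiv R m))
    obtain ⟨Q', N', h'⟩ := ih Q
    refine ⟨Q', max N N', fun K L k _ _ _ A B φ ψ hM x => ?_⟩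
    obtain ⟨y, hy⟩ := h' K L k A B φ ψ (hM.mono subset_rfl (le_max_right _ _)) (Fin.tail x)
    obtain ⟨b, hb⟩ := h K L k A B _ _
      ⟨hM.left.mono (le_max_left _ _), hM.right.mono (le_max_left _ _), hy.sameLead⟩ (x 0)
    refine ⟨Fin.cons b y, hM.left, hM.right, fun P hP => ?_⟩
    have := hb _ (Finset.mem_image_of_mem _ hP)
    have e : ∀ {F : Type} [Field F] (χ : R →+* F) (t : F) (z : Fin m → F),
        ((MvPolynomial.finSuccEquiv R m P).map (MvPolynomial.eval₂Hom χ z)).eval t =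
          MvPolynomial.eval₂Hom χ (Fin.cons t z : Fin (m + 1) → F) P := by
      intro F _ χ t z
      have : (evalRingHom t).comp ((mapRingHom (MvPolynomial.eval₂Hom χ z)).comp
          (MvPolynomial.finSuccEquiv R m : MvPolynomial (Fin (m + 1)) R →+* _)) =
          MvPolynomial.eval₂Hom χ (Fin.cons t z : Fin (m + 1) → F) := by
        refine MvPolynomial.ringHom_ext (fun r => ?_) (fun i => ?_)
        · simp [MvPolynomial.finSuccEquiv_apply]
        · refine Fin.cases ?_ (fun j => ?_) i <;> simp [MvPolynomial.finSuccEquiv_apply]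
      exact congrArg (fun f => f P) this
    rw [e, e] at this
    rwa [Fin.cons_self_tail] at this

end HenselianField

section Hensel

open IsLocalRing

/-- Hensel's lemma at `0` without the assumption that the polynomial is monic. -/
lemma exists_root_of_coeff_one_isUnit {O : Type*} [CommRing O] [IsLocalRing O]
    [HenselianRing O (maximalIdeal O)] (f : O[X]) (h0 : f.coeff 0 ∈ maximalIdeal O)
    (h1 : IsUnit (f.coeff 1)) : ∃ x ∈ maximalIdeal O, f.eval x = 0 := by
  obtain ⟨u, hu⟩ := h1.exists_left_inv
  set m := f.natDegree
  set h : O[X] := ∑ i ∈ Finset.range (m + 1),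
    C (f.coeff (i + 2) * f.coeff 0 ^ i * u ^ (i + 2)) * X ^ (m - i) with hh
  -- `g` is `S ^ (m + 2) * f (f₀ u / S) / f₀`
  set g : O[X] := X ^ (m + 2) + (X ^ (m + 1) + C (f.coeff 0) * h) with hg
  have hdeg : (C (f.coeff 0) * h).degree < (m + 2 : ℕ) := by
    rw [hh, degree_lt_iff_coeff_zero]
    intro j hj
    simp only [finsetSum_coeff, coeff_C_mul, coeff_X_pow]
    rw [Finset.sum_eq_zero fun i _ => by rw [if_neg (by omega), mul_zero], mul_zero]
  have hmonic : g.Monic := by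
    refine monic_X_pow_add ((degree_add_le _ _).trans_lt (max_lt ?_ ?_))
    · exact (degree_X_pow_le _).trans_lt (by exact_mod_cast Nat.lt_succ_self _)
    · exact hdeg
  have hg0 : g.eval (-1) ∈ maximalIdeal O := by
    have : g.eval (-1) = f.coeff 0 * h.eval (-1) := by
      simp [hg]
      ring
    rw [this]
    exact Ideal.mul_mem_right _ _ h0
  have hg1 : IsUnit (Ideal.Quotient.mk (maximalIdeal O) (g.derivative.eval (-1))) := by
    have : g.derivative.eval (-1) = (-1) ^ (m + 1) + f.coeff 0 * h.derivative.eval (-1) := by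
      simp [hg]
      ring
    rw [this, map_add, Ideal.Quotient.eq_zero_iff_mem.2 (Ideal.mul_mem_right _ _ h0), add_zero]
    exact ((isUnit_one.neg).pow _).map _
  obtain ⟨s, hs, hs1⟩ := HenselianRing.is_henselian g hmonic (-1) hg0 hg1
  have hsu : IsUnit s := by
    by_contra hns
    have h2 := (maximalIdeal O).sub_mem ((mem_maximalIdeal _).2 hns) hs1
    rw [sub_sub_cancel] at h2
    exact (mem_maximalIdeal _).1 h2 isUnit_one.neg
  obtain ⟨w, hw⟩ := hsu.exists_left_inv
  refine ⟨f.coeff 0 * (u * w), Ideal.mul_mem_right _ _ h0, ?_⟩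
  have key : s ^ (m + 2) * f.eval (f.coeff 0 * (u * w)) = f.coeff 0 * g.eval s := by
    rw [eval_eq_sum_range' (show f.natDegree < m + 1 + 1 + 1 by omega), Finset.sum_range_succ',
      Finset.sum_range_succ']
    simp only [hg, hh, eval_add, eval_mul, eval_pow, eval_X, eval_C, eval_finsetSum,
      mul_add, Finset.mul_sum]
    have : ∀ i ∈ Finset.range (m + 1), s ^ (m + 2) *
        (f.coeff (i + 1 + 1) * (f.coeff 0 * (u * w)) ^ (i + 1 + 1)) =
        f.coeff 0 * (f.coeff 0 * (f.coeff (i + 2) * f.coeff 0 ^ i * u ^ (i + 2) *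
          s ^ (m - i))) := fun i hi => by
      have hi : m + 2 = (m - i) + (i + 2) := by
        have := Finset.mem_range.1 hi
        omega
      have hws : w ^ (i + 2) * s ^ (i + 2) = 1 := by rw [← mul_pow, hw, one_pow]
      rw [hi, pow_add, mul_pow, mul_pow]
      linear_combination (s ^ (m - i) * f.coeff (i + 2) * f.coeff 0 ^ (i + 2) * u ^ (i + 2)) * hws
    rw [Finset.sum_congr rfl this]
    simp only [zero_add, pow_one, pow_zero, mul_one]
    linear_combination (s ^ (m + 1) * s * w * f.coeff 0) * hu + (s ^ (m + 1) * f.coeff 0) * hw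
  rw [hs.eq_zero, mul_zero] at key
  exact ((hsu.pow _).mul_right_eq_zero).1 key

end Hensel

namespace HenselianField

section DVR

variable {O K k : Type} [CommRing O] [Field K] [Algebra O K] [IsFractionRing O K] [Field k]

open IsDiscreteValuationRing (maximalIdeal)
open IsDedekindDomain.HeightOneSpectrum (valuation)

variable (K) in
open Classical in
/-- The residue map, extended by zero to the fraction field. -/
noncomputable def residueExt (res : O →+* k) (x : K) : k :=
  if h : ∃ u : O, algebraMap O K u = x then res h.choose else 0

lemma residueExt_algebraMap (res : O →+* k) (u : O) :
    residueExt K res (algebraMap O K u) = res u := by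
  have h : ∃ u' : O, algebraMap O K u' = algebraMap O K u := ⟨u, rfl⟩
  rw [residueExt, dif_pos h]
  exact congrArg res (IsFractionRing.injective O K h.choose_spec)

variable [IsDomain O] [IsDiscreteValuationRing O]

variable (O K) in
/-- The valuation of a discrete valuation ring on its fraction field. -/
noncomputable abbrev dvrValuation : Valuation K ℤᵐ⁰ := valuation K (maximalIdeal O)

lemma dvrValuation_lt_one_iff {res : O →+* k}
    (hker : RingHom.ker res = IsLocalRing.maximalIdeal O) (u : O) :
    dvrValuation O K (algebraMap O K u) < 1 ↔ res u = 0 := by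
  rw [← RingHom.mem_ker, hker]
  exact IsDedekindDomain.HeightOneSpectrum.valuation_lt_one_iff_mem _ u

lemma dvrValuation_eq_one_iff {res : O →+* k}
    (hker : RingHom.ker res = IsLocalRing.maximalIdeal O) (u : O) :
    dvrValuation O K (algebraMap O K u) = 1 ↔ res u ≠ 0 := by
  rw [Ne, ← dvrValuation_lt_one_iff (K := K) hker, not_lt]
  exact ⟨fun h => h.ge,
    fun h => h.antisymm' (IsDedekindDomain.HeightOneSpectrum.valuation_le_one _ u)⟩

lemma dvr_hensel {res : O →+* k} (hker : RingHom.ker res = IsLocalRing.maximalIdeal O)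
    [HenselianRing O (IsLocalRing.maximalIdeal O)] (F : K[X])
    (hF : ∀ i, dvrValuation O K (F.coeff i) ≤ 1) (h0 : dvrValuation O K (F.eval 1) < 1)
    (h1 : dvrValuation O K (F.derivative.eval 1) = 1) :
    ∃ β, F.eval β = 0 ∧ dvrValuation O K (β - 1) < 1 := by
  obtain ⟨f, rfl⟩ : ∃ f : O[X], f.map (algebraMap O K) = F := by
    rw [← mem_lifts, lifts_iff_coeff_lifts]
    exact fun i => IsDiscreteValuationRing.exists_lift_of_le_one (hF i)
  have hev : ∀ g : O[X], (g.map (algebraMap O K)).eval 1 = algebraMap O K (g.eval 1) := fun g => by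
    rw [eval_map, ← map_one (algebraMap O K), eval₂_at_apply]
  have hc0 : (taylor 1 f).coeff 0 ∈ IsLocalRing.maximalIdeal O := by
    rw [← hker, RingHom.mem_ker, ← dvrValuation_lt_one_iff (K := K) hker, taylor_coeff_zero,
      ← hev]
    exact h0
  have hc1 : IsUnit ((taylor 1 f).coeff 1) := by
    rw [← not_not (a := IsUnit _), ← mem_nonunits_iff, ← IsLocalRing.mem_maximalIdeal, ← hker,
      RingHom.mem_ker, ← Ne, ← dvrValuation_eq_one_iff (K := K) hker, taylor_coeff_one, ← hev,
      ← derivative_map]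
    exact h1
  obtain ⟨x, hx, hfx⟩ := exists_root_of_coeff_one_isUnit _ hc0 hc1
  refine ⟨algebraMap O K (x + 1), ?_, ?_⟩
  · rw [taylor_eval] at hfx
    rw [eval_map_algebraMap, aeval_algebraMap_apply, coe_aeval_eq_eval, hfx, map_zero]
  · rw [map_add, map_one, add_sub_cancel_right, dvrValuation_lt_one_iff hker, ← RingHom.mem_ker,
      hker]
    exact hx

/-- A Henselian discrete valuation ring with uniformizer `ϖ` makes its fraction field a
`HenselianField`. -/
noncomputable def ofDVR (res : O →+* k) (hker : RingHom.ker res = IsLocalRing.maximalIdeal O)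
    (hsurj : Function.Surjective res) [HenselianRing O (IsLocalRing.maximalIdeal O)] (ϖ : K)
    (hϖ : dvrValuation O K ϖ = exp (-1)) : HenselianField K k :=
  have hϖ0 : ϖ ≠ 0 := by
    rintro rfl
    rw [map_zero] at hϖ
    exact exp_ne_zero hϖ.symm
  have hϖn (n : ℤ) : dvrValuation O K (ϖ ^ n) = exp (-n) := by
    rw [map_zpow₀, hϖ, ← exp_zsmul]
    simp
  have hv {x : K} (hx : x ≠ 0) :
      dvrValuation O K (x * ϖ ^ log (dvrValuation O K x)) = 1 := by
    rw [map_mul, hϖn, exp_neg, exp_log ((Valuation.ne_zero_iff _).2 hx)]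
    exact mul_inv_cancel₀ ((Valuation.ne_zero_iff _).2 hx)
  have hex {x : K} (hx : x ≠ 0) :
      ∃ u : O, algebraMap O K u = x * ϖ ^ log (dvrValuation O K x) :=
    IsDiscreteValuationRing.exists_lift_of_le_one (hv hx).le
  have hlead {γ : ℤᵐ⁰} (hγ : γ ≠ 0) (u : O) :
      (if dvrValuation O K (algebraMap O K u * ϖ ^ (-log γ)) = γ then
        residueExt K res (algebraMap O K u * ϖ ^ (-log γ) *
          ϖ ^ log (dvrValuation O K (algebraMap O K u * ϖ ^ (-log γ)))) else 0) = res u := by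
    split_ifs with h
    · rw [h, mul_assoc, ← zpow_add₀ hϖ0, neg_add_cancel, zpow_zero, mul_one,
        residueExt_algebraMap]
    · rw [map_mul, hϖn, neg_neg, exp_log hγ, mul_eq_right₀ hγ, dvrValuation_eq_one_iff hker] at h
      exact (not_not.1 h).symm
  have hdiv {γ : ℤᵐ⁰} (hγ : γ ≠ 0) {x : K} (hx : dvrValuation O K x ≤ γ) :
      ∃ u : O, x = algebraMap O K u * ϖ ^ (-log γ) := by
    obtain ⟨u, hu⟩ := IsDiscreteValuationRing.exists_lift_of_le_one (A := O) (K := K)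
      (x := x * ϖ ^ log γ) (by
        rw [map_mul, hϖn, exp_neg, exp_log hγ]
        exact mul_inv_le_one_of_le₀ hx zero_le)
    refine ⟨u, ?_⟩
    rw [hu, mul_assoc, ← zpow_add₀ hϖ0, add_neg_cancel, zpow_zero, mul_one]
  { v := dvrValuation O K
    ac :=
      { toFun := fun x => residueExt K res (x * ϖ ^ log (dvrValuation O K x))
        map_zero' := by simpa using residueExt_algebraMap (K := K) res 0
        map_one' := by simpa using residueExt_algebraMap (K := K) res 1
        map_mul' := by
          intro x y
          by_cases hx : x = 0
          · have := residueExt_algebraMap (K := K) res 0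
            simp only [map_zero] at this
            simp [hx, this]
          by_cases hy : y = 0
          · have := residueExt_algebraMap (K := K) res 0
            simp only [map_zero] at this
            simp [hy, this]
          obtain ⟨a, ha⟩ := hex hx
          obtain ⟨b, hb⟩ := hex hy
          have : x * y * ϖ ^ log (dvrValuation O K (x * y)) = algebraMap O K (a * b) := by
            rw [map_mul, map_mul, log_mul ((Valuation.ne_zero_iff _).2 hx)
              ((Valuation.ne_zero_iff _).2 hy), zpow_add₀ hϖ0, ha, hb]
            ring
          rw [this, ← ha, ← hb, residueExt_algebraMap, residueExt_algebraMap,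
            residueExt_algebraMap, map_mul] }
    ac_add := by
      intro γ hγ x y hx hy
      obtain ⟨a, rfl⟩ := hdiv hγ hx
      obtain ⟨b, rfl⟩ := hdiv hγ hy
      rw [← add_mul, ← map_add]
      simp only [MonoidWithZeroHom.coe_mk, ZeroHom.coe_mk]
      rw [hlead hγ, hlead hγ, hlead hγ, map_add]
    exists_lift := by
      intro γ hγ ξ hξ
      obtain ⟨u, rfl⟩ := hsurj ξ
      have h := hlead hγ u
      split_ifs at h with hc
      · exact ⟨_, hc, h⟩
      · exact absurd h.symm hξ
    hensel := fun F hF h0 h1 => dvr_hensel hker F hF h0 h1 }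

lemma ofDVR_v (res : O →+* k) (hker : RingHom.ker res = IsLocalRing.maximalIdeal O)
    (hsurj : Function.Surjective res) [HenselianRing O (IsLocalRing.maximalIdeal O)] (ϖ : K)
    (hϖ : dvrValuation O K ϖ = exp (-1)) {u : O} (hu : res u ≠ 0) :
    (ofDVR res hker hsurj ϖ hϖ).v (algebraMap O K u) = 1 :=
  (dvrValuation_eq_one_iff hker u).2 hu

lemma ofDVR_ac (res : O →+* k) (hker : RingHom.ker res = IsLocalRing.maximalIdeal O)
    (hsurj : Function.Surjective res) [HenselianRing O (IsLocalRing.maximalIdeal O)] (ϖ : K)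
    (hϖ : dvrValuation O K ϖ = exp (-1)) {u : O} (hu : res u ≠ 0) :
    (ofDVR res hker hsurj ϖ hϖ).ac (algebraMap O K u) = res u := by
  change residueExt K res (_ * ϖ ^ log (dvrValuation O K _)) = _
  rw [(dvrValuation_eq_one_iff hker u).2 hu, log_one, zpow_zero, mul_one, residueExt_algebraMap]

/-- The structure of `ofDVR`, as an existence statement recording the leading terms of integers. -/
lemma exists_henselianField (res : O →+* k) (hker : RingHom.ker res = IsLocalRing.maximalIdeal O)
    (hsurj : Function.Surjective res) [HenselianRing O (IsLocalRing.maximalIdeal O)] :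
    ∃ A : HenselianField K k, ∀ n : ℤ, (n : k) ≠ 0 → A.v (n : K) = 1 ∧ A.ac (n : K) = n := by
  obtain ⟨ϖ, hϖ⟩ :=
    IsDedekindDomain.HeightOneSpectrum.valuation_exists_uniformizer K (maximalIdeal O)
  refine ⟨ofDVR res hker hsurj ϖ hϖ, fun n hn => ?_⟩
  have hn' : res (n : O) ≠ 0 := by rwa [map_intCast]
  have h1 := ofDVR_v res hker hsurj ϖ hϖ hn'
  have h2 := ofDVR_ac res hker hsurj ϖ hϖ hn'
  rw [map_intCast (algebraMap O K)] at h1 h2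
  exact ⟨h1, h2.trans (map_intCast res n)⟩

end DVR

theorem exists_henselianField_padic (p : ℕ) [Fact p.Prime] :
    ∃ A : HenselianField ℚ_[p] (ZMod p),
      ∀ n : ℤ, (n : ZMod p) ≠ 0 → A.v (n : ℚ_[p]) = 1 ∧ A.ac (n : ℚ_[p]) = n :=
  exists_henselianField (O := ℤ_[p]) PadicInt.toZMod PadicInt.ker_toZMod
    (ZMod.ringHom_surjective _)

theorem exists_henselianField_laurentSeries (p : ℕ) [Fact p.Prime] :
    ∃ A : HenselianField (LaurentSeries (ZMod p)) (ZMod p),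
      ∀ n : ℤ, (n : ZMod p) ≠ 0 → A.v (n : LaurentSeries (ZMod p)) = 1 ∧
        A.ac (n : LaurentSeries (ZMod p)) = n := by
  have hmax : IsLocalRing.maximalIdeal (PowerSeries (ZMod p)) = Ideal.span {PowerSeries.X} :=
    PowerSeries.maximalIdeal_eq_span_X
  have : IsAdicComplete (IsLocalRing.maximalIdeal (PowerSeries (ZMod p)))
      (PowerSeries (ZMod p)) := by
    rw [hmax]
    infer_instance
  refine exists_henselianField (O := PowerSeries (ZMod p)) PowerSeries.constantCoeff ?_
    PowerSeries.constantCoeff_surj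
  rw [hmax]
  ext f
  rw [RingHom.mem_ker, Ideal.mem_span_singleton, PowerSeries.X_dvd_iff]

end HenselianField
end AxKochen

namespace AxKochen

section QuasiAlgClosed

open MvPolynomial

/-- Evaluation of a form at a scaled vector. -/
lemma eval_mul_of_isHomogeneous {ι R : Type*} [CommRing R] {f : MvPolynomial ι R} {d : ℕ}
    (hf : f.IsHomogeneous d) (c : R) (x : ι → R) :
    eval (fun i => c * x i) f = c ^ d * eval x f := by
  simp only [eval_eq, Finset.mul_sum]
  refine Finset.sum_congr rfl fun s hs => ?_
  rw [hf.degree_eq_sum_deg_support hs, ← Finset.prod_pow_eq_pow_sum]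
  simp only [mul_pow, Finset.prod_mul_distrib]
  ring

variable {σ k : Type*} [Field k]

lemma totalDegree_coeff_mul_le {a b : ℕ} {F G : PowerSeries (MvPolynomial σ k)}
    (hF : ∀ j, (PowerSeries.coeff j F).totalDegree ≤ a)
    (hG : ∀ j, (PowerSeries.coeff j G).totalDegree ≤ b) (j : ℕ) :
    (PowerSeries.coeff j (F * G)).totalDegree ≤ a + b := by
  rw [PowerSeries.coeff_mul]
  exact (totalDegree_finsetSum _ _).trans (Finset.sup_le fun i _ =>
    (totalDegree_mul _ _).trans (add_le_add (hF _) (hG _)))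

lemma totalDegree_coeff_pow_le {F : PowerSeries (MvPolynomial σ k)}
    (hF : ∀ j, (PowerSeries.coeff j F).totalDegree ≤ 1) (e : ℕ) :
    ∀ j, (PowerSeries.coeff j (F ^ e)).totalDegree ≤ e := by
  induction e with
  | zero =>
    intro j
    rw [pow_zero, PowerSeries.coeff_one]
    split_ifs <;> simp
  | succ e ih =>
    rw [pow_succ]
    exact totalDegree_coeff_mul_le ih hF

lemma totalDegree_coeff_prod_le {ι : Type*} (t : Finset ι)
    {F : ι → PowerSeries (MvPolynomial σ k)} {e : ι → ℕ}
    (hF : ∀ i j, (PowerSeries.coeff j (F i)).totalDegree ≤ e i) :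
    ∀ j, (PowerSeries.coeff j (∏ i ∈ t, F i)).totalDegree ≤ ∑ i ∈ t, e i := by
  classical
  induction t using Finset.induction_on with
  | empty =>
    intro j
    rw [Finset.prod_empty, PowerSeries.coeff_one]
    split_ifs <;> simp
  | insert i t hi ih =>
    rw [Finset.prod_insert hi, Finset.sum_insert hi]
    exact totalDegree_coeff_mul_le (hF i) ih

/-- Substituting power series with coefficients of degree at most one into a form of degree `d`
gives a power series with coefficients of degree at most `d`. -/
lemma totalDegree_coeff_eval₂_le {ι : Type*} {d : ℕ} {f : MvPolynomial ι (PowerSeries k)}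
    (hf : f.IsHomogeneous d) {G : ι → PowerSeries (MvPolynomial σ k)}
    (hG : ∀ i j, (PowerSeries.coeff j (G i)).totalDegree ≤ 1) (j : ℕ) :
    (PowerSeries.coeff j (eval₂ (PowerSeries.map C) G f)).totalDegree ≤ d := by
  rw [eval₂_eq, map_sum]
  refine (totalDegree_finsetSum _ _).trans (Finset.sup_le fun s hs => ?_)
  rw [hf.degree_eq_sum_deg_support hs, ← zero_add (∑ i ∈ _, _)]
  refine totalDegree_coeff_mul_le (fun j => ?_)
    (totalDegree_coeff_prod_le _ fun i => totalDegree_coeff_pow_le (hG i) _) j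
  rw [PowerSeries.coeff_map, totalDegree_C]

variable [Finite k]

/-- Approximate primitive zeros of a form in more than `d ^ 2` variables over `k⟦X⟧`. -/
lemma exists_primitive_approximate_zero {d : ℕ} (hd : 1 ≤ d)
    {f : MvPolynomial (Fin (d ^ 2 + 1)) (PowerSeries k)} (hf : f.IsHomogeneous d) (m : ℕ) :
    ∃ x : Fin (d ^ 2 + 1) → PowerSeries k, (∃ i, PowerSeries.constantCoeff (x i) ≠ 0) ∧
      PowerSeries.X ^ m ∣ eval x f := by
  classical
  cases nonempty_fintype k
  obtain ⟨p, _⟩ := CharP.exists k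
  have hp : p.Prime := (CharP.char_is_prime_or_zero k p).resolve_right
    (CharP.char_ne_zero_of_finite k p)
  obtain rfl | hm := m.eq_zero_or_pos
  · exact ⟨1, ⟨0, by simp⟩, by simp⟩
  let G : Fin (d ^ 2 + 1) → PowerSeries (MvPolynomial (Fin (d ^ 2 + 1) × Fin (d * m)) k) :=
    fun i => PowerSeries.mk fun j => if h : j < d * m then X (i, ⟨j, h⟩) else 0
  have hG : ∀ i j, (PowerSeries.coeff j (G i)).totalDegree ≤ 1 := by
    intro i j
    rw [PowerSeries.coeff_mk]
    split_ifs <;> simp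
  let P : ℕ → MvPolynomial (Fin (d ^ 2 + 1) × Fin (d * m)) k := fun j =>
    PowerSeries.coeff j (eval₂ (PowerSeries.map C) G f)
  let g : (Fin (d ^ 2 + 1) × Fin (d * m) → k) → Fin (d ^ 2 + 1) → PowerSeries k := fun y i =>
    PowerSeries.map (eval y) (G i)
  have hg : ∀ y i j, PowerSeries.coeff j (g y i) = if h : j < d * m then y (i, ⟨j, h⟩) else 0 := by
    intro y i j
    rw [PowerSeries.coeff_map, PowerSeries.coeff_mk]
    split_ifs <;> simp
  have hP : ∀ y j, eval y (P j) = PowerSeries.coeff j (eval (g y) f) := by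
    intro y j
    rw [← PowerSeries.coeff_map, hom_eval₂]
    congr 2
    ext a j
    simp
  have hdeg : ∑ j ∈ Finset.range (d ^ 2 * m + m - 1), (P j).totalDegree <
      Fintype.card (Fin (d ^ 2 + 1) × Fin (d * m)) := by
    refine (Finset.sum_le_card_nsmul _ _ d fun j _ =>
      totalDegree_coeff_eval₂_le hf hG j).trans_lt ?_
    rw [Finset.card_range, smul_eq_mul, Fintype.card_prod, Fintype.card_fin, Fintype.card_fin]
    calc (d ^ 2 * m + m - 1) * d < (d ^ 2 * m + m) * d :=
          Nat.mul_lt_mul_of_pos_right (by omega) hd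
      _ = _ := by ring
  have hcard := char_dvd_card_solutions_of_sum_lt p hdeg
  have hzero : ∀ j ∈ Finset.range (d ^ 2 * m + m - 1), eval 0 (P j) = 0 := by
    intro j _
    have h0 : g 0 = fun i => 0 * g 0 i := by
      ext i j
      rw [hg, zero_mul]
      simp
    rw [hP, h0, eval_mul_of_isHomogeneous hf, zero_pow (by omega), zero_mul, map_zero]
  obtain ⟨⟨y, hy⟩, hy0⟩ := Fintype.exists_ne_of_one_lt_card
    (hp.one_lt.trans_le (Nat.le_of_dvd (Fintype.card_pos_iff.2 ⟨⟨0, hzero⟩⟩) hcard)) ⟨0, hzero⟩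
  obtain ⟨⟨i₀, j₀⟩, hij⟩ := Function.ne_iff.1 (fun h => hy0 (Subtype.ext h) : y ≠ 0)
  have hex : ∃ s i, PowerSeries.coeff s (g y i) ≠ 0 :=
    ⟨j₀, i₀, by rw [hg, dif_pos j₀.2]; exact hij⟩
  have hdvd : ∀ i, PowerSeries.X ^ Nat.find hex ∣ g y i := fun i =>
    PowerSeries.X_pow_dvd_iff.2 fun j hj => by
      have := Nat.find_min hex hj
      push Not at this
      exact this i
  choose x hx using hdvd
  obtain ⟨i, hi⟩ := Nat.find_spec hex
  have hs : Nat.find hex < d * m := by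
    by_contra h
    rw [hg, dif_neg h] at hi
    exact hi rfl
  refine ⟨x, ⟨i, fun h => hi ?_⟩, ?_⟩
  · rw [hx i, PowerSeries.coeff_X_pow_mul', if_pos le_rfl, Nat.sub_self,
      PowerSeries.coeff_zero_eq_constantCoeff_apply, h]
  · have h1 : PowerSeries.X ^ (d ^ 2 * m + m - 1) ∣ eval (g y) f :=
      PowerSeries.X_pow_dvd_iff.2 fun j hj => by rw [← hP, hy j (Finset.mem_range.2 hj)]
    rw [funext hx, eval_mul_of_isHomogeneous hf, ← pow_mul] at h1
    have h2 : Nat.find hex * d + m ≤ d ^ 2 * m + m - 1 := by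
      have : (Nat.find hex + 1) * d ≤ d * m * d := Nat.mul_le_mul_right d hs
      have e : d * m * d = d ^ 2 * m := by ring
      rw [e, add_mul, one_mul] at this
      omega
    have h3 := (pow_dvd_pow PowerSeries.X h2).trans h1
    rw [pow_add] at h3
    exact (mul_dvd_mul_iff_left (pow_ne_zero _ PowerSeries.X_ne_zero)).1 h3

/-- A form of degree `d` in more than `d ^ 2` variables over `k⟦X⟧` has a nontrivial zero. -/
lemma exists_zero_powerSeries {d : ℕ} (hd : 1 ≤ d)
    {f : MvPolynomial (Fin (d ^ 2 + 1)) (PowerSeries k)} (hf : f.IsHomogeneous d) :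
    ∃ x : Fin (d ^ 2 + 1) → PowerSeries k, x ≠ 0 ∧ eval x f = 0 := by
  open PowerSeries.WithPiTopology in
  let _ : TopologicalSpace k := ⊥
  have : DiscreteTopology k := ⟨rfl⟩
  have : CompactSpace (PowerSeries k) := inferInstanceAs (CompactSpace ((Unit →₀ ℕ) → k))
  let T : ℕ → Set (Fin (d ^ 2 + 1) → PowerSeries k) := fun m =>
    {x | (∃ i, PowerSeries.constantCoeff (x i) ≠ 0) ∧ PowerSeries.X ^ m ∣ eval x f}
  have hT : ∀ m, IsClosed (T m) := by
    intro m
    have hTm : T m = (⋃ i, {x | PowerSeries.constantCoeff (x i) ≠ 0}) ∩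
        ⋂ j : Fin m, {x | PowerSeries.coeff (j : ℕ) (eval x f) = 0} := by
      ext x
      simp [T, PowerSeries.X_pow_dvd_iff, Fin.forall_iff]
    rw [hTm]
    refine IsClosed.inter (isClosed_iUnion_of_finite fun i => ?_) (isClosed_iInter fun j => ?_)
    · exact (isClosed_discrete {a : k | a ≠ 0}).preimage
        ((PowerSeries.WithPiTopology.continuous_constantCoeff k).comp (continuous_apply i))
    · exact isClosed_eq ((PowerSeries.WithPiTopology.continuous_coeff k j).comp
        (MvPolynomial.continuous_eval f)) continuous_const
  obtain ⟨x, hx⟩ := IsCompact.nonempty_iInter_of_sequence_nonempty_isCompact_isClosed T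
    (fun m x hx => ⟨hx.1, (pow_dvd_pow _ m.le_succ).trans hx.2⟩)
    (exists_primitive_approximate_zero hd hf) (hT 0).isCompact hT
  rw [Set.mem_iInter] at hx
  refine ⟨x, ?_, ?_⟩
  · rintro rfl
    obtain ⟨i, hi⟩ := (hx 0).1
    exact hi (by simp)
  · ext j
    exact PowerSeries.X_pow_dvd_iff.1 (hx (j + 1)).2 j j.lt_succ_self

/-- A form of degree `d` in more than `d ^ 2` variables over `k⸨X⸩` has a nontrivial zero. -/
theorem exists_zero_laurentSeries {d : ℕ} (hd : 1 ≤ d)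
    {f : MvPolynomial (Fin (d ^ 2 + 1)) (LaurentSeries k)} (hf : f.IsHomogeneous d) :
    ∃ x : Fin (d ^ 2 + 1) → LaurentSeries k, x ≠ 0 ∧ eval x f = 0 := by
  classical
  obtain ⟨b, hb⟩ := IsLocalization.exist_integer_multiples_of_finset
    (nonZeroDivisors (PowerSeries k)) (f.support.image f.coeff)
  have hinj := IsFractionRing.injective (PowerSeries k) (LaurentSeries k)
  have hb0 : algebraMap (PowerSeries k) (LaurentSeries k) b ≠ 0 := by
    rw [Ne, map_eq_zero_iff _ hinj]
    exact nonZeroDivisors.coe_ne_zero b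
  obtain ⟨g, hg⟩ : C (algebraMap (PowerSeries k) (LaurentSeries k) b) * f ∈
      Set.range (map (algebraMap (PowerSeries k) (LaurentSeries k))) := by
    rw [mem_range_map_iff_coeffs_subset]
    intro a ha
    obtain ⟨s, hs, rfl⟩ := mem_coeffs_iff.1 (Finset.mem_coe.1 ha)
    rw [mem_support_iff, coeff_C_mul] at hs
    obtain ⟨c, hc⟩ := hb (f.coeff s) (Finset.mem_image_of_mem _
      (mem_support_iff.2 (right_ne_zero_of_mul hs)))
    exact ⟨c, by rw [hc, coeff_C_mul, Algebra.smul_def]⟩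
  have hgd : g.IsHomogeneous d := by
    refine IsHomogeneous.of_map hinj ?_
    rw [hg]
    exact hf.C_mul _
  obtain ⟨x, hx0, hx⟩ := exists_zero_powerSeries hd hgd
  refine ⟨fun i => algebraMap _ _ (x i), fun h => hx0 (funext fun i => ?_), ?_⟩
  · exact (map_eq_zero_iff _ hinj).1 (congrFun h i)
  · have h := congrArg (eval fun i => algebraMap (PowerSeries k) (LaurentSeries k) (x i)) hg
    rw [eval_map, ← Function.comp_def, ← eval₂_comp, hx, map_zero, map_mul, eval_C] at h
    exact (mul_eq_zero.1 h.symm).resolve_left hb0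

end QuasiAlgClosed

section Transfer

open MvPolynomial HenselianField

/-- The polynomial with monomials in `T` and coefficients `c`. -/
noncomputable def formOf {n : ℕ} {R : Type} [CommRing R] (T : Finset (Fin n →₀ ℕ))
    (c : Fin T.card → R) : MvPolynomial (Fin n) R :=
  ∑ s : T, monomial s.1 (c (T.equivFin s))

lemma formOf_isHomogeneous {n : ℕ} {R : Type} [CommRing R] {T : Finset (Fin n →₀ ℕ)} {d : ℕ}
    (hT : ∀ s ∈ T, s.degree = d) (c : Fin T.card → R) : (formOf T c).IsHomogeneous d :=
  IsHomogeneous.sum _ _ _ fun s _ => isHomogeneous_monomial _ (hT s.1 s.2)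

lemma formOf_coeff {n : ℕ} {R : Type} [CommRing R] {T : Finset (Fin n →₀ ℕ)}
    {f : MvPolynomial (Fin n) R} (hf : f.support ⊆ T) :
    formOf T (fun j => f.coeff (T.equivFin.symm j).1) = f := by
  simp only [formOf, Equiv.symm_apply_apply]
  rw [Finset.sum_coe_sort T fun s => monomial s (f.coeff s)]
  conv_rhs => rw [f.as_sum]
  exact (Finset.sum_subset hf fun s _ hs => by
    rw [notMem_support_iff.1 hs, monomial_zero]).symm

lemma eval₂Hom_formOf {n : ℕ} {R K : Type} [CommRing R] [CommRing K] (T : Finset (Fin n →₀ ℕ))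
    (c : Fin T.card → R) (φ : R →+* K) (x : Fin n → K) :
    eval₂Hom φ x (formOf T c) = eval x (formOf T (φ ∘ c)) := by
  simp [formOf, eval₂_monomial, eval_monomial]

/-- Existence of nontrivial zeros of polynomials with given monomials transfers between Henselian
fields with the same residue field whenever finitely many integers have the same leading terms. -/
theorem exists_transfer_zero {n : ℕ} (T : Finset (Fin n →₀ ℕ)) :
    ∃ (Q : Finset ℤ) (N : ℕ), ∀ (K L k : Type) [Field K] [Field L] [Field k]
      (A : HenselianField K k) (B : HenselianField L k),
      Matches A B (Int.castRingHom K) (Int.castRingHom L) Q N →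
      (∀ c : Fin T.card → L, ∃ x : Fin n → L, x ≠ 0 ∧ eval x (formOf T c) = 0) →
      ∀ c : Fin T.card → K, ∃ x : Fin n → K, x ≠ 0 ∧ eval x (formOf T c) = 0 := by
  classical
  obtain ⟨Q₁, N₁, h₁⟩ := exists_transfer_mvPolynomial n
    (R := MvPolynomial (Fin T.card) ℤ) (insert (formOf T X) (Finset.univ.image X))
  obtain ⟨Q₂, N₂, h₂⟩ := exists_transfer_mvPolynomial T.card Q₁
  refine ⟨Q₂, max N₁ N₂, fun K L k _ _ _ A B hAB hL c => ?_⟩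
  obtain ⟨c', hc'⟩ := h₂ K L k A B _ _ (hAB.mono subset_rfl (le_max_right _ _)) c
  obtain ⟨x', hx0, hx'⟩ := hL c'
  have hBA : Matches B A (eval₂Hom (Int.castRingHom L) c') (eval₂Hom (Int.castRingHom K) c)
      Q₁ N₁ :=
    ⟨fun m h h' => hAB.right m h (h'.trans (le_max_left _ _)),
      fun m h h' => hAB.left m h (h'.trans (le_max_left _ _)),
      fun q hq => (hc'.sameLead q hq).symm⟩
  obtain ⟨x, hx⟩ := h₁ L K k B A _ _ hBA x'
  have hcomp : ∀ {F : Type} [Field F] (c : Fin T.card → F),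
      (eval₂Hom (Int.castRingHom F) c) ∘ X = c := fun c => funext fun i => by simp
  refine ⟨x, fun h => hx0 (funext fun i => ?_), ?_⟩
  · have h1 := hx.sameLead (X i) (Finset.mem_insert_of_mem (Finset.mem_image_of_mem _
      (Finset.mem_univ i)))
    simp only [eval₂Hom_X'] at h1
    exact h1.eq_zero_iff.2 (congrFun h i)
  · have h1 := hx.sameLead _ (Finset.mem_insert_self _ _)
    rw [eval₂Hom_formOf, eval₂Hom_formOf, hcomp, hcomp] at h1
    exact h1.eq_zero_iff.1 hx'

/-- For large `p`, finitely many integers have the same leading terms in `ℚ_p` and in the field of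
Laurent series over `𝔽_p`. -/
lemma matches_padic_laurentSeries (Q : Finset ℤ) (N p : ℕ) [hp : Fact p.Prime] (hN : N < p)
    (hQ : ∀ q ∈ Q, q.natAbs < p) :
    ∃ (A : HenselianField ℚ_[p] (ZMod p)) (B : HenselianField (LaurentSeries (ZMod p)) (ZMod p)),
      Matches A B (Int.castRingHom _) (Int.castRingHom _) Q N := by
  obtain ⟨A, hA⟩ := exists_henselianField_padic p
  obtain ⟨B, hB⟩ := exists_henselianField_laurentSeries p
  have hcast : ∀ q : ℤ, q ≠ 0 → q.natAbs < p → (q : ZMod p) ≠ 0 := by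
    intro q hq h h0
    rw [ZMod.intCast_zmod_eq_zero_iff_dvd, Int.natCast_dvd] at h0
    exact absurd (Nat.le_of_dvd (Int.natAbs_pos.2 hq) h0) (not_le.2 h)
  refine ⟨A, B, ⟨fun m h h' => ?_, fun m h h' => ?_, fun q hq => ?_⟩⟩
  · exact_mod_cast (hA m (hcast m (by omega) (by omega))).1
  · exact_mod_cast (hB m (hcast m (by omega) (by omega))).1
  · obtain rfl | hq0 := eq_or_ne q 0
    · simpa only [map_zero] using SameLead.zero
    · have h0 := hcast q hq0 (hQ q hq)
      simp only [eq_intCast]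
      exact ⟨(hA q h0).1.trans (hB q h0).1.symm, (hA q h0).2.trans (hB q h0).2.symm⟩

/-- Nontrivial zeros of forms in `m` variables give nontrivial zeros of forms in more variables. -/
lemma exists_zero_of_le {K : Type} [Field K] {d m n : ℕ} (hmn : m ≤ n)
    (h : ∀ φ : MvPolynomial (Fin m) K, φ.IsHomogeneous d →
      ∃ x : Fin m → K, x ≠ 0 ∧ eval x φ = 0)
    {φ : MvPolynomial (Fin n) K} (hφ : φ.IsHomogeneous d) :
    ∃ x : Fin n → K, x ≠ 0 ∧ eval x φ = 0 := by
  let r : Fin n → MvPolynomial (Fin m) K := fun i => if hi : i < m then X ⟨i, hi⟩ else 0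
  have hr : ∀ i, (r i).IsHomogeneous 1 := by
    intro i
    simp only [r]
    split_ifs
    · exact isHomogeneous_X _ _
    · exact isHomogeneous_zero _ _ _
  obtain ⟨x, hx0, hx⟩ := h (aeval r φ) (by simpa using hφ.aeval r hr)
  refine ⟨fun i => eval x (r i), fun h0 => hx0 (funext fun i => ?_), ?_⟩
  · simpa [r] using congrFun h0 (Fin.castLE hmn i)
  · rw [aeval_def] at hx
    rw [← hx, hom_eval₂, algebraMap_eq,
      show (eval x).comp C = RingHom.id K from RingHom.ext fun a => eval_C a]
    rfl

end Transfer
end AxKochen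

open MvPolynomial

/-- **Ax–Kochen**: for every degree `d ≥ 1` there is a finite set `S` of primes such that for
every prime `p ∉ S` and every `n > d²`, every homogeneous polynomial of degree `d` in `n`
variables over `ℚ_p` has a nontrivial zero in `ℚ_pⁿ`. -/
theorem ax_kochen (d : ℕ) (hd : 1 ≤ d) :
    ∃ S : Finset ℕ, ∀ (p : ℕ) (hp : p.Prime), p ∉ S → ∀ n : ℕ, d ^ 2 < n →
      haveI : Fact p.Prime := ⟨hp⟩
      ∀ φ : MvPolynomial (Fin n) ℚ_[p], φ.IsHomogeneous d →
        ∃ x : Fin n → ℚ_[p], x ≠ 0 ∧ eval x φ = 0 := by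
  set T := (Finset.univ : Finset (Fin (d ^ 2 + 1))).finsuppAntidiag d
  have hT : ∀ s, s ∈ T ↔ s.degree = d := fun s => by
    simp [T, Finset.mem_finsuppAntidiag, Finsupp.degree_eq_sum]
  obtain ⟨Q, N, hQN⟩ := AxKochen.exists_transfer_zero T
  refine ⟨Finset.range (max N (Q.sup Int.natAbs) + 1), fun p hp hpS n hn => ?_⟩
  have : Fact p.Prime := ⟨hp⟩
  intro φ hφ
  have hpS' : max N (Q.sup Int.natAbs) < p := by
    rwa [Finset.mem_range, not_lt] at hpS
  obtain ⟨A, B, hAB⟩ := AxKochen.matches_padic_laurentSeries Q N p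
    ((le_max_left _ _).trans_lt hpS')
    fun q hq => ((Finset.le_sup hq).trans (le_max_right _ _)).trans_lt hpS'
  have hzero := hQN _ _ _ A B hAB fun c => AxKochen.exists_zero_laurentSeries hd
    (AxKochen.formOf_isHomogeneous (fun s hs => (hT s).1 hs) c)
  refine AxKochen.exists_zero_of_le hn (fun ψ hψ => ?_) hφ
  have hsupp : ψ.support ⊆ T := fun s hs =>
    (hT s).2 (hψ.degree_eq_sum_deg_support hs).symm
  simpa only [AxKochen.formOf_coeff hsupp] using hzero fun j => ψ.coeff (T.equivFin.symm j).1
end
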